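/- arXiv:2402.04076 — 3 statements merged into one kernel-verified Lean document; each statement's English description precedes it below -/
import Mathlib

section
/- Let n ≥ 1 be an integer, s ∈ (0,2), and let u : ℝⁿ → ℝ be bounded and continuous. Define U(x,z) := ∫_{ℝⁿ} P_s(x−y, z) u(y) dy for x ∈ ℝⁿ, z > 0. Then U is smooth on ℝⁿ × (0,∞), satisfies the degenerate elliptic equation Δ_x U(x,z) + ∂_{zz} U(x,z) + ((1−s)/z) ∂_z U(x,z) = 0 at every point of ℝⁿ × (0,∞), and for every x ∈ ℝⁿ one has lim_{z→0⁺} U(x,z) = u(x). -/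
open MeasureTheory Real Set Filter Topology

/-- `σ_{n,s} = Γ((n+s)/2) / (π^{n/2} Γ(s/2))`. -/
noncomputable def sigmaConst (n : ℕ) (s : ℝ) : ℝ :=
  Real.Gamma (((n : ℝ) + s) / 2) / (Real.pi ^ ((n : ℝ) / 2) * Real.Gamma (s / 2))

/-- `K` is smooth away from the origin and positively homogeneous of degree `-a`. -/
structure IsSmoothHomogeneous {V G : Type*} [NormedAddCommGroup V] [NormedSpace ℝ V]
    [NormedAddCommGroup G] [NormedSpace ℝ G] (a : ℝ) (K : V → G) : Prop where
  contDiffOn : ContDiffOn ℝ (⊤ : ℕ∞) K {0}ᶜ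
  map_smul : ∀ c : ℝ, 0 < c → ∀ q : V, q ≠ 0 → K (c • q) = c ^ (-a) • K q

namespace IsSmoothHomogeneous

section Basic

variable {V G : Type*} [NormedAddCommGroup V] [NormedSpace ℝ V]
  [NormedAddCommGroup G] [NormedSpace ℝ G] {a : ℝ} {K : V → G}

theorem contDiffAt (hK : IsSmoothHomogeneous a K) {q : V} (hq : q ≠ 0) :
    ContDiffAt ℝ (⊤ : ℕ∞) K q :=
  hK.contDiffOn.contDiffAt (isOpen_compl_singleton.mem_nhds hq)

theorem differentiableAt (hK : IsSmoothHomogeneous a K) {q : V} (hq : q ≠ 0) :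
    DifferentiableAt ℝ K q :=
  (hK.contDiffAt hq).differentiableAt (by simp)

protected theorem fderiv (hK : IsSmoothHomogeneous a K) :
    IsSmoothHomogeneous (a + 1) (fderiv ℝ K) where
  contDiffOn := hK.contDiffOn.fderiv_of_isOpen isOpen_compl_singleton (by simp)
  map_smul c hc q hq := by
    have h1 : fderiv ℝ (fun p => K (c • p)) q = c • fderiv ℝ K (c • q) := by
      rw [fderiv_comp_smul]
    have h2 : fderiv ℝ (fun p => K (c • p)) q = c ^ (-a) • fderiv ℝ K q := by
      have : (fun p => K (c • p)) =ᶠ[𝓝 q] fun p => c ^ (-a) • K p := by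
        filter_upwards [isOpen_compl_singleton.mem_nhds hq] with p hp
        exact hK.map_smul c hc p hp
      rw [this.fderiv_eq, fderiv_fun_const_smul (hK.differentiableAt hq)]
    have h3 : c ^ (-(a + 1)) = c⁻¹ * c ^ (-a) := by
      rw [neg_add, rpow_add hc, rpow_neg_one, mul_comm]
    rw [h3, mul_smul, ← h2, h1, smul_smul, inv_mul_cancel₀ hc.ne', one_smul]

theorem exists_norm_le [FiniteDimensional ℝ V] (hK : IsSmoothHomogeneous a K) :
    ∃ C, 0 ≤ C ∧ ∀ q : V, q ≠ 0 → ‖K q‖ ≤ C * ‖q‖ ^ (-a) := by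
  have hc : ContinuousOn K (Metric.sphere (0 : V) 1) :=
    hK.contDiffOn.continuousOn.mono fun q hq => by
      rintro rfl
      simp at hq
  obtain ⟨C, hC⟩ := (isCompact_sphere (0 : V) 1).exists_bound_of_continuousOn hc
  refine ⟨|C|, abs_nonneg C, fun q hq => ?_⟩
  have hq' : 0 < ‖q‖ := norm_pos_iff.2 hq
  have h := hK.map_smul ‖q‖ hq' (‖q‖⁻¹ • q) (smul_ne_zero (inv_ne_zero hq'.ne') hq)
  rw [smul_smul, mul_inv_cancel₀ hq'.ne', one_smul] at h
  rw [h, norm_smul, norm_of_nonneg (rpow_nonneg hq'.le _), mul_comm]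
  gcongr
  refine (hC _ ?_).trans (le_abs_self C)
  simp [norm_smul, hq'.ne']

end Basic

end IsSmoothHomogeneous

section Translation

variable {E : Type*} [NormedAddCommGroup E]

theorem sub_prodMk_zero_ne_zero {q : E × ℝ} (hq : 0 < q.2) (y : E) : q - (y, 0) ≠ 0 := by
  intro h
  have := congrArg Prod.snd h
  simp at this
  exact hq.ne' this

theorem exists_ball_rpow_norm_sub_le {a : ℝ} (ha : 0 ≤ a) {q₀ : E × ℝ} (hq₀ : 0 < q₀.2) :
    ∃ ε > 0, ∃ B, 0 ≤ B ∧ ∀ q ∈ Metric.ball q₀ ε, 0 < q.2 ∧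
      ∀ y : E, ‖q - (y, 0)‖ ^ (-a) ≤ B * (1 + ‖y‖) ^ (-a) := by
  obtain ⟨x₀, z₀⟩ := q₀
  simp only at hq₀
  set A : ℝ := 1 + (1 + ‖x₀‖ + z₀ / 2) / (z₀ / 2) with hA
  have hA0 : 0 < A := by positivity
  refine ⟨z₀ / 2, by positivity, A ^ a, by positivity, ?_⟩
  rintro ⟨x, z⟩ hq
  rw [← ball_prod_same, mem_prod, Metric.mem_ball, Metric.mem_ball, dist_eq_norm,
    Real.dist_eq] at hq
  obtain ⟨hx, hz⟩ := hq
  simp only at hx hz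
  have hz' : z₀ / 2 < z := by linarith [(abs_lt.1 hz).1]
  refine ⟨by simp only; linarith, fun y => ?_⟩
  have h1 : ‖x - y‖ ≤ ‖((x, z) : E × ℝ) - (y, 0)‖ := by
    simp
  have h2 : z₀ / 2 ≤ ‖((x, z) : E × ℝ) - (y, 0)‖ := by
    refine le_trans ?_ (norm_snd_le (((x, z) : E × ℝ) - (y, 0)))
    simpa using hz'.le.trans (le_abs_self z)
  set N := ‖((x, z) : E × ℝ) - (y, 0)‖
  have h3 : ‖y‖ ≤ ‖x - y‖ + (z₀ / 2 + ‖x₀‖) := by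
    have e1 : ‖y‖ ≤ ‖x - y‖ + ‖x‖ := by
      have := norm_sub_le x (x - y)
      rw [sub_sub_cancel] at this
      linarith
    have e2 : ‖x‖ ≤ ‖x - x₀‖ + ‖x₀‖ := by simpa using norm_add_le (x - x₀) x₀
    linarith
  have h4 : 1 + ‖y‖ ≤ A * N := by
    have : 1 + ‖x₀‖ + z₀ / 2 ≤ (1 + ‖x₀‖ + z₀ / 2) / (z₀ / 2) * N := by
      rw [div_mul_eq_mul_div, le_div_iff₀ (by positivity)]
      gcongr
    rw [hA, add_mul, one_mul]
    linarith
  have h5 : (1 + ‖y‖) / A ≤ N := by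
    rw [div_le_iff₀ hA0]
    linarith
  calc N ^ (-a) ≤ ((1 + ‖y‖) / A) ^ (-a) :=
        rpow_le_rpow_of_nonpos (by positivity) h5 (by linarith)
    _ = A ^ a * (1 + ‖y‖) ^ (-a) := by
        rw [div_rpow (by positivity) hA0.le, rpow_neg hA0.le, div_inv_eq_mul, mul_comm]

end Translation

namespace IsSmoothHomogeneous

variable {E G : Type*} [NormedAddCommGroup E] [NormedSpace ℝ E] [FiniteDimensional ℝ E]
  [MeasurableSpace E] [BorelSpace E] {μ : Measure E}
  [NormedAddCommGroup G] [NormedSpace ℝ G] {a : ℝ} {K : E × ℝ → G} {u : E → ℝ} {M : ℝ}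

theorem aestronglyMeasurable_smul_translate (hK : IsSmoothHomogeneous a K) (hu : Continuous u)
    {q : E × ℝ} (hq : 0 < q.2) :
    AEStronglyMeasurable (fun y => u y • K (q - (y, 0))) μ := by
  refine (hu.smul ?_).aestronglyMeasurable
  refine hK.contDiffOn.continuousOn.comp_continuous (by fun_prop) fun y => ?_
  exact sub_prodMk_zero_ne_zero hq y

variable [μ.IsAddHaarMeasure]

theorem exists_ball_norm_smul_translate_le (ha : Module.finrank ℝ E < a)
    (hK : IsSmoothHomogeneous a K) (hM : ∀ y, |u y| ≤ M) {q₀ : E × ℝ} (hq₀ : 0 < q₀.2) :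
    ∃ ε > 0, ∃ g : E → ℝ, Integrable g μ ∧ ∀ q ∈ Metric.ball q₀ ε, 0 < q.2 ∧
      ∀ y, ‖u y • K (q - (y, 0))‖ ≤ g y := by
  have ha0 : 0 ≤ a := (Nat.cast_nonneg _).trans ha.le
  obtain ⟨C, hC0, hC⟩ := hK.exists_norm_le
  obtain ⟨ε, hε, B, hB0, hB⟩ := exists_ball_rpow_norm_sub_le ha0 hq₀
  have hM0 : 0 ≤ M := (abs_nonneg _).trans (hM 0)
  refine ⟨ε, hε, fun y => M * (C * (B * (1 + ‖y‖) ^ (-a))),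
    (((integrable_one_add_norm ha).const_mul B).const_mul C).const_mul M, fun q hq => ?_⟩
  obtain ⟨hq2, hqB⟩ := hB q hq
  refine ⟨hq2, fun y => ?_⟩
  beta_reduce
  rw [norm_smul, Real.norm_eq_abs]
  gcongr
  · exact hM y
  · refine (hC _ (sub_prodMk_zero_ne_zero hq2 y)).trans ?_
    gcongr
    exact hqB y

theorem integrable_smul_translate (ha : Module.finrank ℝ E < a) (hK : IsSmoothHomogeneous a K)
    (hu : Continuous u) (hM : ∀ y, |u y| ≤ M) {q : E × ℝ} (hq : 0 < q.2) :
    Integrable (fun y => u y • K (q - (y, 0))) μ := by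
  obtain ⟨ε, hε, g, hg, h⟩ := exists_ball_norm_smul_translate_le (μ := μ) ha hK hM hq
  exact hg.mono' (hK.aestronglyMeasurable_smul_translate hu hq)
    (.of_forall (h q (Metric.mem_ball_self hε)).2)

theorem hasFDerivAt_integral_smul_translate (ha : Module.finrank ℝ E < a)
    (hK : IsSmoothHomogeneous a K) (hu : Continuous u) (hM : ∀ y, |u y| ≤ M)
    {q : E × ℝ} (hq : 0 < q.2) :
    HasFDerivAt (fun q => ∫ y, u y • K (q - (y, 0)) ∂μ)
      (∫ y, u y • fderiv ℝ K (q - (y, 0)) ∂μ) q := by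
  obtain ⟨ε, hε, g, hg, h⟩ := exists_ball_norm_smul_translate_le (μ := μ)
    (ha.trans (lt_add_one a)) hK.fderiv hM hq
  have hball := Metric.ball_mem_nhds q hε
  refine hasFDerivAt_integral_of_dominated_of_fderiv_le hball ?_
    (hK.integrable_smul_translate ha hu hM hq)
    (hK.fderiv.aestronglyMeasurable_smul_translate hu hq)
    (.of_forall fun y p hp => (h p hp).2 y) hg (.of_forall fun y p hp => ?_)
  · filter_upwards [hball] with p hp
    exact hK.aestronglyMeasurable_smul_translate hu (h p hp).1
  · refine HasFDerivAt.const_smul ?_ (u y)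
    exact (hasFDerivAt_comp_sub (y, 0)).2
      (hK.differentiableAt (sub_prodMk_zero_ne_zero (h p hp).1 y)).hasFDerivAt

theorem fderiv_integral_smul_translate (ha : Module.finrank ℝ E < a)
    (hK : IsSmoothHomogeneous a K) (hu : Continuous u) (hM : ∀ y, |u y| ≤ M)
    {q : E × ℝ} (hq : 0 < q.2) :
    fderiv ℝ (fun q => ∫ y, u y • K (q - (y, 0)) ∂μ) q =
      ∫ y, u y • fderiv ℝ K (q - (y, 0)) ∂μ :=
  (hK.hasFDerivAt_integral_smul_translate ha hu hM hq).fderiv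

end IsSmoothHomogeneous

theorem isOpen_setOf_snd_pos {E : Type*} [TopologicalSpace E] :
    IsOpen {q : E × ℝ | 0 < q.2} :=
  isOpen_lt continuous_const continuous_snd

theorem IsSmoothHomogeneous.contDiffOn_integral_smul_translate_nat.{v} {E : Type v}
    [NormedAddCommGroup E] [NormedSpace ℝ E] [FiniteDimensional ℝ E] [MeasurableSpace E]
    [BorelSpace E] {μ : Measure E} [μ.IsAddHaarMeasure] {u : E → ℝ} {M : ℝ}
    (hu : Continuous u) (hM : ∀ y, |u y| ≤ M) (m : ℕ)
    {G : Type v} [NormedAddCommGroup G] [NormedSpace ℝ G] {a : ℝ} {K : E × ℝ → G}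
    (ha : Module.finrank ℝ E < a) (hK : IsSmoothHomogeneous a K) :
    ContDiffOn ℝ m (fun q => ∫ y, u y • K (q - (y, 0)) ∂μ) {q : E × ℝ | 0 < q.2} := by
  induction m generalizing G a with
  | zero =>
    refine contDiffOn_zero.2 fun q hq => ?_
    exact (hK.hasFDerivAt_integral_smul_translate ha hu hM hq).continuousAt.continuousWithinAt
  | succ m ih =>
    rw [Nat.cast_add, Nat.cast_one, contDiffOn_succ_iff_fderiv_of_isOpen isOpen_setOf_snd_pos]
    refine ⟨fun q hq => ?_, by simp, ?_⟩
    · exact (hK.hasFDerivAt_integral_smul_translate ha hu hM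
        hq).differentiableAt.differentiableWithinAt
    · exact (ih (ha.trans (lt_add_one a)) hK.fderiv).congr fun q hq =>
        hK.fderiv_integral_smul_translate ha hu hM hq

theorem IsSmoothHomogeneous.contDiffOn_integral_smul_translate.{v} {E : Type v}
    [NormedAddCommGroup E] [NormedSpace ℝ E] [FiniteDimensional ℝ E] [MeasurableSpace E]
    [BorelSpace E] {μ : Measure E} [μ.IsAddHaarMeasure] {u : E → ℝ} {M : ℝ} {G : Type v}
    [NormedAddCommGroup G] [NormedSpace ℝ G] {a : ℝ} {K : E × ℝ → G}
    (hK : IsSmoothHomogeneous a K) (hu : Continuous u) (hM : ∀ y, |u y| ≤ M)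
    (ha : Module.finrank ℝ E < a) :
    ContDiffOn ℝ (⊤ : ℕ∞) (fun q => ∫ y, u y • K (q - (y, 0)) ∂μ) {q : E × ℝ | 0 < q.2} :=
  contDiffOn_infty.2 fun m => hK.contDiffOn_integral_smul_translate_nat hu hM m ha

theorem deriv_comp_add_smul {V : Type*} [NormedAddCommGroup V] [NormedSpace ℝ V] {f : V → ℝ}
    {p e : V} {t : ℝ} (hf : DifferentiableAt ℝ f (p + t • e)) :
    deriv (fun r : ℝ => f (p + r • e)) t = fderiv ℝ f (p + t • e) e := by
  have h : HasDerivAt (fun r : ℝ => p + r • e) e t := by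
    simpa using ((hasDerivAt_id t).smul_const e).const_add p
  exact (hf.hasFDerivAt.comp_hasDerivAt t h).deriv

theorem hasDerivAt_deriv_comp_add_smul {V : Type*} [NormedAddCommGroup V] [NormedSpace ℝ V]
    {f : V → ℝ} {p e : V} {t : ℝ} (hf : ContDiffAt ℝ 2 f (p + t • e)) :
    HasDerivAt (deriv fun r : ℝ => f (p + r • e))
      (fderiv ℝ (fderiv ℝ f) (p + t • e) e e) t := by
  have h : HasDerivAt (fun r : ℝ => p + r • e) e t := by
    simpa using ((hasDerivAt_id t).smul_const e).const_add p
  have h1 : ∀ᶠ r : ℝ in 𝓝 t, deriv (fun r : ℝ => f (p + r • e)) r = fderiv ℝ f (p + r • e) e := by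
    filter_upwards [h.continuousAt.eventually (hf.eventually (by simp))] with r hr
    exact deriv_comp_add_smul (hr.differentiableAt (by simp))
  have h2 : DifferentiableAt ℝ (fderiv ℝ f) (p + t • e) :=
    (hf.fderiv_right (m := 1) (by norm_num [one_add_one_eq_two])).differentiableAt (by simp)
  refine HasDerivAt.congr_of_eventuallyEq ?_ h1
  have h3 : HasDerivAt (fun r : ℝ => fderiv ℝ f (p + r • e))
      (fderiv ℝ (fderiv ℝ f) (p + t • e) e) t :=
    h2.hasFDerivAt.comp_hasDerivAt t h
  exact ((ContinuousLinearMap.apply ℝ ℝ e).hasFDerivAt.comp_hasDerivAt t h3)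

theorem hasDerivAt_quadratic_rpow {A B b t : ℝ} (h : 0 < A + 2 * B * t + t ^ 2) :
    HasDerivAt (fun t : ℝ => (A + 2 * B * t + t ^ 2) ^ (-b))
      (-2 * b * ((B + t) * (A + 2 * B * t + t ^ 2) ^ (-b - 1))) t := by
  have h1 : HasDerivAt (fun t : ℝ => A + 2 * B * t + t ^ 2) (2 * B + 2 * t) t := by
    simpa using (((hasDerivAt_id' t).const_mul (2 * B)).const_add A).fun_add
      ((hasDerivAt_id' t).fun_pow 2)
  convert h1.rpow_const (p := -b) (Or.inl h.ne') using 1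
  ring

theorem deriv_quadratic_rpow_zero {A B b : ℝ} (hA : 0 < A) :
    deriv (fun t : ℝ => (A + 2 * B * t + t ^ 2) ^ (-b)) 0 = -2 * b * (B * A ^ (-b - 1)) := by
  simpa using (hasDerivAt_quadratic_rpow (A := A) (B := B) (b := b) (t := 0) (by simpa)).deriv

theorem deriv_deriv_quadratic_rpow_zero {A B b : ℝ} (hA : 0 < A) :
    deriv (deriv fun t : ℝ => (A + 2 * B * t + t ^ 2) ^ (-b)) 0 =
      -2 * b * (A ^ (-b - 1) - 2 * (b + 1) * (B ^ 2 * A ^ (-b - 2))) := by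
  have h0 : ∀ᶠ t : ℝ in 𝓝 0, 0 < A + 2 * B * t + t ^ 2 := by
    refine ContinuousAt.eventually_lt (by fun_prop) (by fun_prop) (by simpa)
  have h1 : (deriv fun t : ℝ => (A + 2 * B * t + t ^ 2) ^ (-b)) =ᶠ[𝓝 0]
      fun t => -2 * b * ((B + t) * (A + 2 * B * t + t ^ 2) ^ (-b - 1)) :=
    h0.mono fun t ht => (hasDerivAt_quadratic_rpow ht).deriv
  rw [h1.deriv_eq]
  have h2 := hasDerivAt_quadratic_rpow (A := A) (B := B) (b := b + 1) (t := 0) (by simpa)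
  have h3 := ((((hasDerivAt_id (0 : ℝ)).const_add B).mul h2).const_mul (-2 * b)).deriv
  have e1 : -(b + 1) = -b - 1 := by ring
  have e2 : -b - 1 - 1 = -b - 2 := by ring
  simp only [e1, e2] at h3
  refine Eq.trans h3 ?_
  simp only [id_eq, mul_zero, add_zero, ne_eq, OfNat.ofNat_ne_zero, not_false_eq_true, zero_pow]
  ring

/-- The kernel `(‖x‖² + z²)^(-b)` on `E × ℝ`. -/
noncomputable def inversePowerKernel (E : Type*) [NormedAddCommGroup E] (b : ℝ) (q : E × ℝ) : ℝ :=
  (‖q.1‖ ^ 2 + q.2 ^ 2) ^ (-b)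

section Kernel

variable {E : Type*} [NormedAddCommGroup E]

theorem norm_fst_sq_add_snd_sq_pos {q : E × ℝ} (hq : q ≠ 0) : 0 < ‖q.1‖ ^ 2 + q.2 ^ 2 := by
  by_cases h : q.1 = 0
  · have : q.2 ≠ 0 := fun h' => hq (Prod.ext h h')
    positivity
  · positivity

variable [InnerProductSpace ℝ E]

theorem isSmoothHomogeneous_inversePowerKernel (b : ℝ) :
    IsSmoothHomogeneous (2 * b) (inversePowerKernel E b) where
  contDiffOn := by
    refine ContDiffOn.rpow_const_of_ne (ContDiff.contDiffOn ?_) fun q hq =>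
      (norm_fst_sq_add_snd_sq_pos hq).ne'
    exact (contDiff_fst.norm_sq ℝ).add (contDiff_snd.pow 2)
  map_smul c hc q _ := by
    have h : ‖(c • q).1‖ ^ 2 + (c • q).2 ^ 2 = c ^ 2 * (‖q.1‖ ^ 2 + q.2 ^ 2) := by
      simp only [Prod.smul_fst, Prod.smul_snd, norm_smul, smul_eq_mul, Real.norm_eq_abs, mul_pow,
        sq_abs]
      ring
    rw [inversePowerKernel, h, mul_rpow (by positivity) (by positivity), ← rpow_natCast,
      ← rpow_mul hc.le, smul_eq_mul, inversePowerKernel]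
    congr 2
    push_cast
    ring

theorem inversePowerKernel_line_fst (b : ℝ) (x e : E) (he : ‖e‖ = 1) (z r : ℝ) :
    inversePowerKernel E b ((x, z) + r • (e, (0 : ℝ))) =
      ((‖x‖ ^ 2 + z ^ 2) + 2 * inner ℝ x e * r + r ^ 2) ^ (-b) := by
  rw [inversePowerKernel]
  congr 1
  simp only [Prod.smul_mk, Prod.mk_add_mk, smul_zero, add_zero]
  rw [norm_add_sq_real, norm_smul, he, inner_smul_right, Real.norm_eq_abs, mul_one, sq_abs]
  ring

theorem inversePowerKernel_line_snd (b : ℝ) (x : E) (z r : ℝ) :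
    inversePowerKernel E b ((x, z) + r • ((0 : E), (1 : ℝ))) =
      ((‖x‖ ^ 2 + z ^ 2) + 2 * z * r + r ^ 2) ^ (-b) := by
  rw [inversePowerKernel]
  congr 1
  simp only [Prod.smul_mk, Prod.mk_add_mk, smul_zero, add_zero, smul_eq_mul, mul_one]
  ring

theorem contDiffAt_inversePowerKernel (b : ℝ) {q : E × ℝ} (hq : q ≠ 0) :
    ContDiffAt ℝ 2 (inversePowerKernel E b) q :=
  ((isSmoothHomogeneous_inversePowerKernel b).contDiffAt hq).of_le
    (WithTop.coe_le_coe.2 (le_top (a := (2 : ℕ∞))))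

theorem fderiv_fderiv_inversePowerKernel_fst (b : ℝ) {x : E} {z : ℝ} (hz : 0 < z) {e : E}
    (he : ‖e‖ = 1) :
    fderiv ℝ (fderiv ℝ (inversePowerKernel E b)) (x, z) (e, 0) (e, 0) =
      -2 * b * ((‖x‖ ^ 2 + z ^ 2) ^ (-b - 1) -
        2 * (b + 1) * (inner ℝ x e ^ 2 * (‖x‖ ^ 2 + z ^ 2) ^ (-b - 2))) := by
  have hq : ((x, z) : E × ℝ) ≠ 0 := fun h => hz.ne' (congrArg Prod.snd h)
  have h := (hasDerivAt_deriv_comp_add_smul (f := inversePowerKernel E b) (p := (x, z))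
    (e := (e, 0)) (t := 0) (by simpa using contDiffAt_inversePowerKernel b hq)).deriv
  rw [zero_smul, add_zero] at h
  rw [← h, funext (inversePowerKernel_line_fst b x e he z),
    deriv_deriv_quadratic_rpow_zero (by positivity)]

theorem fderiv_fderiv_inversePowerKernel_snd (b : ℝ) {x : E} {z : ℝ} (hz : 0 < z) :
    fderiv ℝ (fderiv ℝ (inversePowerKernel E b)) (x, z) (0, 1) (0, 1) =
      -2 * b * ((‖x‖ ^ 2 + z ^ 2) ^ (-b - 1) -
        2 * (b + 1) * (z ^ 2 * (‖x‖ ^ 2 + z ^ 2) ^ (-b - 2))) := by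
  have hq : ((x, z) : E × ℝ) ≠ 0 := fun h => hz.ne' (congrArg Prod.snd h)
  have h := (hasDerivAt_deriv_comp_add_smul (f := inversePowerKernel E b) (p := (x, z))
    (e := (0, 1)) (t := 0) (by simpa using contDiffAt_inversePowerKernel b hq)).deriv
  rw [zero_smul, add_zero] at h
  rw [← h, funext (inversePowerKernel_line_snd b x z),
    deriv_deriv_quadratic_rpow_zero (by positivity)]

theorem fderiv_inversePowerKernel_snd (b : ℝ) {x : E} {z : ℝ} (hz : 0 < z) :
    fderiv ℝ (inversePowerKernel E b) (x, z) (0, 1) =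
      -2 * b * (z * (‖x‖ ^ 2 + z ^ 2) ^ (-b - 1)) := by
  have hq : ((x, z) : E × ℝ) ≠ 0 := fun h => hz.ne' (congrArg Prod.snd h)
  have h := deriv_comp_add_smul (f := inversePowerKernel E b) (p := (x, z))
    (e := (0, 1)) (t := 0)
    (by simpa using (isSmoothHomogeneous_inversePowerKernel b).differentiableAt hq)
  rw [zero_smul, add_zero] at h
  rw [← h, funext (inversePowerKernel_line_snd b x z), deriv_quadratic_rpow_zero (by positivity)]

/-- Up to the factor `z ^ s`, the Poisson kernel solves the conjugated extension equation. -/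
theorem inversePowerKernel_equation {ι : Type*} [Fintype ι] (v : OrthonormalBasis ι ℝ E) (s : ℝ)
    {x : E} {z : ℝ} (hz : 0 < z) :
    ∑ i, fderiv ℝ (fderiv ℝ (inversePowerKernel E ((Fintype.card ι + s) / 2))) (x, z)
          (v i, 0) (v i, 0) +
      fderiv ℝ (fderiv ℝ (inversePowerKernel E ((Fintype.card ι + s) / 2))) (x, z) (0, 1) (0, 1) +
      (1 + s) / z * fderiv ℝ (inversePowerKernel E ((Fintype.card ι + s) / 2)) (x, z) (0, 1)
        = 0 := by
  set b : ℝ := (Fintype.card ι + s) / 2 with hb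
  have hA : 0 < ‖x‖ ^ 2 + z ^ 2 := by positivity
  have hsum : ∑ i, inner ℝ x (v i) ^ 2 = ‖x‖ ^ 2 := by
    simpa [Real.norm_eq_abs, sq_abs] using v.sum_sq_norm_inner_left x
  have hpow : (‖x‖ ^ 2 + z ^ 2) ^ (-b - 1) =
      (‖x‖ ^ 2 + z ^ 2) * (‖x‖ ^ 2 + z ^ 2) ^ (-b - 2) := by
    rw [show -b - 1 = 1 + (-b - 2) by ring, rpow_add hA, rpow_one]
  simp_rw [fun i => fderiv_fderiv_inversePowerKernel_fst b (x := x) hz (v.norm_eq_one i),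
    fderiv_fderiv_inversePowerKernel_snd b (x := x) hz,
    fderiv_inversePowerKernel_snd b (x := x) hz]
  rw [← Finset.mul_sum, Finset.sum_sub_distrib, ← Finset.mul_sum, ← Finset.sum_mul, hsum,
    Finset.sum_const, Finset.card_univ, nsmul_eq_mul, hpow]
  have hc : (Fintype.card ι : ℝ) = 2 * b - s := by rw [hb]; ring
  rw [hc]
  field_simp
  ring

end Kernel

section Gamma

variable {E : Type*} [NormedAddCommGroup E] [InnerProductSpace ℝ E] [FiniteDimensional ℝ E]
  [MeasurableSpace E] [BorelSpace E]

theorem integral_Ioi_rpow_mul_exp_neg_mul {b c : ℝ} (hb : 0 < b) (hc : 0 < c) :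
    ∫ t in Ioi (0 : ℝ), t ^ (b - 1) * rexp (-(c * t)) = Gamma b * c ^ (-b) := by
  rw [Real.integral_rpow_mul_exp_neg_mul_Ioi hb hc, one_div, inv_rpow hc.le, rpow_neg hc.le,
    mul_comm]

theorem integrableOn_Ioi_rpow_mul_exp_neg_mul {b c : ℝ} (hb : 0 < b) (hc : 0 < c) :
    IntegrableOn (fun t : ℝ => t ^ (b - 1) * rexp (-(c * t))) (Ioi 0) := by
  simpa using integrableOn_rpow_mul_exp_neg_mul_rpow (p := 1) (s := b - 1) (b := c)
    (by linarith) one_pos hc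

theorem integral_one_add_norm_sq_rpow_neg {b : ℝ} (hb : (Module.finrank ℝ E : ℝ) / 2 < b) :
    ∫ w : E, (1 + ‖w‖ ^ 2) ^ (-b) =
      π ^ ((Module.finrank ℝ E : ℝ) / 2) * Gamma (b - Module.finrank ℝ E / 2) / Gamma b := by
  set d : ℝ := (Module.finrank ℝ E : ℝ) / 2 with hd
  have hd0 : 0 ≤ d := by positivity
  have hb0 : 0 < b := hd0.trans_lt hb
  have hc (w : E) : 0 < 1 + ‖w‖ ^ 2 := by positivity
  have hint : Integrable (fun w : E => (1 + ‖w‖ ^ 2) ^ (-b)) := by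
    have := integrable_rpow_neg_one_add_norm_sq (E := E) (μ := volume) (r := 2 * b)
      (by rw [hd] at hb; linarith)
    simpa [neg_div] using this
  have hprod : Integrable (Function.uncurry fun (w : E) (t : ℝ) =>
      t ^ (b - 1) * rexp (-((1 + ‖w‖ ^ 2) * t))) (volume.prod (volume.restrict (Ioi 0))) := by
    refine (integrable_prod_iff (Measurable.aestronglyMeasurable (by fun_prop))).2
      ⟨.of_forall fun w => integrableOn_Ioi_rpow_mul_exp_neg_mul hb0 (hc w), ?_⟩
    refine (hint.const_mul (Gamma b)).congr (.of_forall fun w => ?_)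
    beta_reduce
    rw [← integral_Ioi_rpow_mul_exp_neg_mul hb0 (hc w)]
    refine setIntegral_congr_fun measurableSet_Ioi fun t ht => ?_
    exact (norm_of_nonneg (mul_nonneg (rpow_nonneg (le_of_lt ht) _) (exp_nonneg _))).symm
  have hswap := integral_integral_swap hprod
  have hleft : ∫ w : E, ∫ t in Ioi (0 : ℝ), t ^ (b - 1) * rexp (-((1 + ‖w‖ ^ 2) * t)) =
      Gamma b * ∫ w : E, (1 + ‖w‖ ^ 2) ^ (-b) := by
    simp_rw [fun w : E => integral_Ioi_rpow_mul_exp_neg_mul hb0 (hc w)]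
    exact integral_const_mul _ _
  have hright : ∫ t in Ioi (0 : ℝ), ∫ w : E, t ^ (b - 1) * rexp (-((1 + ‖w‖ ^ 2) * t)) =
      π ^ d * Gamma (b - d) := by
    have h (t : ℝ) (ht : t ∈ Ioi (0 : ℝ)) :
        ∫ w : E, t ^ (b - 1) * rexp (-((1 + ‖w‖ ^ 2) * t)) =
          π ^ d * (t ^ (b - d - 1) * rexp (-(1 * t))) := by
      have ht' : 0 < t := ht
      have h1 (w : E) : t ^ (b - 1) * rexp (-((1 + ‖w‖ ^ 2) * t)) =
          t ^ (b - 1) * rexp (-(1 * t)) * rexp (-t * ‖w‖ ^ 2) := by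
        rw [mul_assoc, ← exp_add]
        ring_nf
      simp_rw [h1]
      rw [integral_const_mul, GaussianFourier.integral_rexp_neg_mul_sq_norm ht',
        div_rpow pi_pos.le ht'.le, show b - d - 1 = b - 1 - d by ring, rpow_sub ht' (b - 1) d]
      ring
    rw [setIntegral_congr_fun measurableSet_Ioi h, integral_const_mul,
      integral_Ioi_rpow_mul_exp_neg_mul (by linarith) one_pos, one_rpow, mul_one]
  rw [eq_div_iff (Gamma_pos_of_pos hb0).ne', mul_comm, ← hleft, hswap, hright]

theorem integral_translate_eq_integral_scaled {u : E → ℝ} (b : ℝ) (x : E) {z : ℝ} (hz : 0 < z) :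
    ∫ y, (‖x - y‖ ^ 2 + z ^ 2) ^ (-b) * u y =
      z ^ (Module.finrank ℝ E - 2 * b) * ∫ w : E, (1 + ‖w‖ ^ 2) ^ (-b) * u (x - z • w) := by
  have h1 : ∫ y, (‖x - y‖ ^ 2 + z ^ 2) ^ (-b) * u y =
      ∫ y, (‖y‖ ^ 2 + z ^ 2) ^ (-b) * u (x - y) := by
    rw [← integral_sub_left_eq_self _ volume x]
    simp
  have h2 := Measure.integral_comp_smul (volume : Measure E)
    (fun y => (‖y‖ ^ 2 + z ^ 2) ^ (-b) * u (x - y)) z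
  have h3 (w : E) : (‖z • w‖ ^ 2 + z ^ 2) ^ (-b) * u (x - z • w) =
      z ^ (-2 * b) * ((1 + ‖w‖ ^ 2) ^ (-b) * u (x - z • w)) := by
    have : ‖z • w‖ ^ 2 + z ^ 2 = z ^ 2 * (1 + ‖w‖ ^ 2) := by
      rw [norm_smul, Real.norm_eq_abs, mul_pow, sq_abs]
      ring
    rw [this, mul_rpow (by positivity) (by positivity), ← rpow_natCast, ← rpow_mul hz.le,
      mul_assoc]
    congr 2
    push_cast
    ring
  simp_rw [h3] at h2
  rw [integral_const_mul, abs_of_pos (by positivity), smul_eq_mul] at h2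
  rw [h1, sub_eq_add_neg, rpow_add hz, rpow_natCast, mul_assoc, ← neg_mul, h2, ← mul_assoc,
    mul_inv_cancel₀ (by positivity), one_mul]

theorem tendsto_integral_scaled {u : E → ℝ} (hu : Continuous u) {M : ℝ} (hM : ∀ y, |u y| ≤ M)
    {b : ℝ} (hb : (Module.finrank ℝ E : ℝ) / 2 < b) (x : E) :
    Tendsto (fun z : ℝ => ∫ w : E, (1 + ‖w‖ ^ 2) ^ (-b) * u (x - z • w)) (𝓝 0)
      (𝓝 ((∫ w : E, (1 + ‖w‖ ^ 2) ^ (-b)) * u x)) := by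
  have hint : Integrable (fun w : E => (1 + ‖w‖ ^ 2) ^ (-b)) := by
    have := integrable_rpow_neg_one_add_norm_sq (E := E) (μ := volume) (r := 2 * b)
      (by linarith)
    simpa [neg_div] using this
  rw [← integral_mul_const]
  refine tendsto_integral_filter_of_dominated_convergence (fun w => (1 + ‖w‖ ^ 2) ^ (-b) * M)
    (.of_forall fun z => hint.aestronglyMeasurable.mul
      (Continuous.aestronglyMeasurable (by fun_prop)))
    (.of_forall fun z => .of_forall fun w => ?_) (hint.mul_const M) (.of_forall fun w => ?_)
  · rw [norm_mul, norm_of_nonneg (by positivity), Real.norm_eq_abs]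
    gcongr
    exact hM _
  · have : Continuous fun z : ℝ => (1 + ‖w‖ ^ 2) ^ (-b) * u (x - z • w) := by fun_prop
    simpa using this.tendsto 0

end Gamma

section Equation

variable {E : Type} [NormedAddCommGroup E] [InnerProductSpace ℝ E] [FiniteDimensional ℝ E]
  [MeasurableSpace E] [BorelSpace E] {u : E → ℝ} {M : ℝ}

/-- The convolution of `u` with `(‖x‖² + z²)^(-b)` in the first variable. -/
noncomputable def inversePowerPotential (b : ℝ) (u : E → ℝ) (q : E × ℝ) : ℝ :=
  ∫ y, u y • inversePowerKernel E b (q - (y, 0))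

theorem contDiffOn_inversePowerPotential {b : ℝ} (hb : Module.finrank ℝ E < 2 * b)
    (hu : Continuous u) (hM : ∀ y, |u y| ≤ M) :
    ContDiffOn ℝ (⊤ : ℕ∞) (inversePowerPotential b u) {q : E × ℝ | 0 < q.2} :=
  (isSmoothHomogeneous_inversePowerKernel b).contDiffOn_integral_smul_translate hu hM hb

theorem fderiv_inversePowerPotential_apply {b : ℝ} (hb : Module.finrank ℝ E < 2 * b)
    (hu : Continuous u) (hM : ∀ y, |u y| ≤ M) {q : E × ℝ} (hq : 0 < q.2) (e : E × ℝ) :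
    fderiv ℝ (inversePowerPotential b u) q e =
      ∫ y, u y * fderiv ℝ (inversePowerKernel E b) (q - (y, 0)) e := by
  have hK := isSmoothHomogeneous_inversePowerKernel (E := E) b
  have h := hK.fderiv_integral_smul_translate (μ := volume) hb hu hM hq
  refine (congrArg (fun L => L e) h).trans ?_
  exact ContinuousLinearMap.integral_apply
    (hK.fderiv.integrable_smul_translate (hb.trans (lt_add_one _)) hu hM hq) e

theorem fderiv_fderiv_inversePowerPotential_apply {b : ℝ} (hb : Module.finrank ℝ E < 2 * b)
    (hu : Continuous u) (hM : ∀ y, |u y| ≤ M) {q : E × ℝ} (hq : 0 < q.2) (e e' : E × ℝ) :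
    fderiv ℝ (fderiv ℝ (inversePowerPotential b u)) q e e' =
      ∫ y, u y * fderiv ℝ (fderiv ℝ (inversePowerKernel E b)) (q - (y, 0)) e e' := by
  have hK := isSmoothHomogeneous_inversePowerKernel (E := E) b
  have hb' := hb.trans (lt_add_one _)
  have h1 : fderiv ℝ (inversePowerPotential b u) =ᶠ[𝓝 q]
      fun q => ∫ y, u y • fderiv ℝ (inversePowerKernel E b) (q - (y, 0)) := by
    filter_upwards [isOpen_setOf_snd_pos.mem_nhds hq] with p hp
    exact hK.fderiv_integral_smul_translate (μ := volume) hb hu hM hp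
  have hint := hK.fderiv.fderiv.integrable_smul_translate (μ := volume)
    (hb'.trans (lt_add_one _)) hu hM hq
  rw [h1.fderiv_eq, hK.fderiv.fderiv_integral_smul_translate hb' hu hM hq,
    ContinuousLinearMap.integral_apply hint, ContinuousLinearMap.integral_apply
      (hint.apply_continuousLinearMap e)]
  rfl

theorem inversePowerPotential_equation {ι : Type*} [Fintype ι] (v : OrthonormalBasis ι ℝ E)
    {s : ℝ} (hs : 0 < s) (hu : Continuous u) (hM : ∀ y, |u y| ≤ M) {x : E} {z : ℝ} (hz : 0 < z) :
    ∑ i, fderiv ℝ (fderiv ℝ (inversePowerPotential ((Fintype.card ι + s) / 2) u)) (x, z)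
          (v i, 0) (v i, 0) +
      fderiv ℝ (fderiv ℝ (inversePowerPotential ((Fintype.card ι + s) / 2) u)) (x, z)
          (0, 1) (0, 1) +
      (1 + s) / z * fderiv ℝ (inversePowerPotential ((Fintype.card ι + s) / 2) u) (x, z) (0, 1)
        = 0 := by
  have hb : (Module.finrank ℝ E : ℝ) < 2 * ((Fintype.card ι + s) / 2) := by
    rw [Module.finrank_eq_card_basis v.toBasis]
    linarith
  have hb' := hb.trans (lt_add_one _)
  have hK := isSmoothHomogeneous_inversePowerKernel (E := E) ((Fintype.card ι + s) / 2)
  have hq : 0 < ((x, z) : E × ℝ).2 := hz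
  have hint1 (e : E × ℝ) := (hK.fderiv.integrable_smul_translate (μ := volume)
    hb' hu hM hq).apply_continuousLinearMap e
  have hint2 (e : E × ℝ) := ((hK.fderiv.fderiv.integrable_smul_translate (μ := volume)
    (hb'.trans (lt_add_one _)) hu hM hq).apply_continuousLinearMap e).apply_continuousLinearMap e
  simp only [smul_apply, smul_eq_mul] at hint1 hint2
  simp_rw [fun e e' => fderiv_fderiv_inversePowerPotential_apply hb hu hM hq e e',
    fun e => fderiv_inversePowerPotential_apply hb hu hM hq e]
  rw [← integral_finsetSum _ fun i _ => hint2 _, ← integral_const_mul,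
    ← integral_add (integrable_finsetSum _ fun i _ => hint2 _) (hint2 _),
    ← integral_add ((integrable_finsetSum _ fun i _ => hint2 _).fun_add (hint2 _))
      ((hint1 _).const_mul _)]
  refine integral_eq_zero_of_ae (.of_forall fun y => ?_)
  have h := inversePowerKernel_equation v s (x := x - y) hz
  have hxy : ((x, z) : E × ℝ) - (y, 0) = (x - y, z) := by simp
  simp only [hxy, Pi.zero_apply, ← Finset.mul_sum]
  linear_combination u y * h

end Equation

theorem poisson_conjugation_identity {s z : ℝ} (hz : 0 < z) {f f' : ℝ → ℝ} {f'' : ℝ}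
    (hf : ∀ w, 0 < w → HasDerivAt f (f' w) w) (hf' : HasDerivAt f' f'' z) :
    deriv (deriv fun w => w ^ s * f w) z + (1 - s) / z * deriv (fun w => w ^ s * f w) z =
      z ^ s * (f'' + (1 + s) / z * f' z) := by
  have h1 (w : ℝ) (hw : 0 < w) :
      HasDerivAt (fun w => w ^ s * f w) (s * w ^ (s - 1) * f w + w ^ s * f' w) w :=
    (hasDerivAt_rpow_const (Or.inl hw.ne')).mul (hf w hw)
  have h2 : deriv (fun w => w ^ s * f w) =ᶠ[𝓝 z]
      fun w => s * w ^ (s - 1) * f w + w ^ s * f' w := by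
    filter_upwards [lt_mem_nhds hz] with w hw
    exact (h1 w hw).deriv
  have h3 : HasDerivAt (fun w => s * w ^ (s - 1) * f w + w ^ s * f' w)
      ((s * ((s - 1) * z ^ (s - 1 - 1))) * f z + s * z ^ (s - 1) * f' z +
        (s * z ^ (s - 1) * f' z + z ^ s * f'')) z :=
    (((hasDerivAt_rpow_const (Or.inl hz.ne')).const_mul s).mul (hf z hz)).add
      ((hasDerivAt_rpow_const (Or.inl hz.ne')).mul hf')
  rw [h2.deriv_eq, h3.deriv, (h1 z hz).deriv, rpow_sub_one hz.ne' (s - 1), rpow_sub_one hz.ne' s]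
  field_simp
  ring

/-- Euclidean Caffarelli–Silvestre extension: the Poisson extension `U` of a bounded
continuous function `u` is smooth on `ℝⁿ × (0,∞)`, satisfies
`Δ_x U + ∂_{zz} U + ((1-s)/z) ∂_z U = 0` there, and attains `u` as `z → 0⁺`. -/
theorem poisson_extension_properties (n : ℕ) (hn : 1 ≤ n) (s : ℝ) (hs : s ∈ Ioo (0:ℝ) 2)
    (u : EuclideanSpace ℝ (Fin n) → ℝ) (hu : Continuous u) (M : ℝ) (hM : ∀ x, |u x| ≤ M)
    (U : EuclideanSpace ℝ (Fin n) → ℝ → ℝ)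
    (hU : ∀ x z, U x z =
      ∫ y, sigmaConst n s * z ^ s / (‖x - y‖ ^ 2 + z ^ 2) ^ (((n : ℝ) + s) / 2) * u y) :
    ContDiffOn ℝ (⊤ : ℕ∞) (fun q : EuclideanSpace ℝ (Fin n) × ℝ => U q.1 q.2)
      {q : EuclideanSpace ℝ (Fin n) × ℝ | 0 < q.2} ∧
    (∀ (x : EuclideanSpace ℝ (Fin n)) (z : ℝ), 0 < z →
      (∑ i : Fin n,
          deriv (deriv (fun r : ℝ => U (x + r • EuclideanSpace.single i (1:ℝ)) z)) 0) +
        deriv (deriv (fun w : ℝ => U x w)) z +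
        ((1 - s) / z) * deriv (fun w : ℝ => U x w) z = 0) ∧
    (∀ x : EuclideanSpace ℝ (Fin n),
      Tendsto (fun z : ℝ => U x z) (𝓝[>] (0:ℝ)) (𝓝 (u x))) := by
  have hs0 : 0 < s := hs.1
  set b : ℝ := ((n : ℝ) + s) / 2 with hbdef
  have hfin : Module.finrank ℝ (EuclideanSpace ℝ (Fin n)) = n := by simp
  have hb : (Module.finrank ℝ (EuclideanSpace ℝ (Fin n)) : ℝ) < 2 * b := by
    rw [hfin, hbdef]
    linarith
  have hker (x y : EuclideanSpace ℝ (Fin n)) (z : ℝ) :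
      sigmaConst n s * z ^ s / (‖x - y‖ ^ 2 + z ^ 2) ^ b * u y =
        sigmaConst n s * z ^ s * ((‖x - y‖ ^ 2 + z ^ 2) ^ (-b) * u y) := by
    rw [rpow_neg (by positivity)]
    ring
  have hUV (x : EuclideanSpace ℝ (Fin n)) (z : ℝ) :
      U x z = sigmaConst n s * (z ^ s * inversePowerPotential b u (x, z)) := by
    simp_rw [hU, hker]
    rw [integral_const_mul, mul_assoc, inversePowerPotential]
    congr 3
    ext y
    simp [inversePowerKernel, mul_comm]
  have hV := contDiffOn_inversePowerPotential hb hu hM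
  have hV2 {q : EuclideanSpace ℝ (Fin n) × ℝ} (hq : 0 < q.2) :
      ContDiffAt ℝ 2 (inversePowerPotential b u) q :=
    (hV.contDiffAt (isOpen_setOf_snd_pos.mem_nhds hq)).of_le
      (WithTop.coe_le_coe.2 (le_top (a := (2 : ℕ∞))))
  refine ⟨?_, fun x z hz => ?_, fun x => ?_⟩
  · simp_rw [hUV]
    refine contDiffOn_const.mul (ContDiffOn.mul ?_ hV)
    exact contDiffOn_snd.rpow_const_of_ne fun q hq => (mem_ofPred.1 hq).ne'
  · have hx (i : Fin n) :
        deriv (deriv (fun r : ℝ => U (x + r • EuclideanSpace.single i (1:ℝ)) z)) 0 =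
          sigmaConst n s * (z ^ s * fderiv ℝ (fderiv ℝ (inversePowerPotential b u)) (x, z)
            (EuclideanSpace.single i 1, 0) (EuclideanSpace.single i 1, 0)) := by
      have h := (hasDerivAt_deriv_comp_add_smul (f := inversePowerPotential b u) (p := (x, z))
        (e := (EuclideanSpace.single i (1 : ℝ), (0 : ℝ))) (t := 0)
        (by simpa using hV2 (q := (x, z)) hz)).deriv
      simp only [zero_smul, add_zero, Prod.smul_mk, Prod.mk_add_mk, smul_zero] at h
      rw [← h]
      simp_rw [hUV]
      simp only [deriv_const_mul_field']
    have hline (w : ℝ) : ((x, 0) : EuclideanSpace ℝ (Fin n) × ℝ) + w • (0, (1 : ℝ)) = (x, w) := by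
      simp
    have hd1 (w : ℝ) (hw : 0 < w) : HasDerivAt (fun w => inversePowerPotential b u (x, w))
        (deriv (fun w => inversePowerPotential b u (x, w)) w) w := by
      have h : DifferentiableAt ℝ (fun w : ℝ => ((x, w) : EuclideanSpace ℝ (Fin n) × ℝ)) w := by
        fun_prop
      exact (DifferentiableAt.comp w ((hV2 (q := (x, w)) hw).differentiableAt
        (by simp)) h).hasDerivAt
    have hd2 := hasDerivAt_deriv_comp_add_smul (f := inversePowerPotential b u) (p := (x, 0))
      (e := (0, 1)) (t := z) (by rw [hline]; exact hV2 (q := (x, z)) hz)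
    have hd3 := deriv_comp_add_smul (f := inversePowerPotential b u) (p := (x, 0))
      (e := (0, 1)) (t := z) (by
        rw [hline]
        exact (hV2 (q := (x, z)) hz).differentiableAt (by simp))
    simp only [hline] at hd2 hd3
    have hconj := poisson_conjugation_identity (s := s) hz hd1 hd2
    have heq := inversePowerPotential_equation (EuclideanSpace.basisFun (Fin n) ℝ) hs0 hu hM
      (x := x) hz
    simp only [Fintype.card_fin, EuclideanSpace.basisFun_apply, ← hbdef] at heq
    simp_rw [hx, hUV]
    simp only [deriv_const_mul_field']
    rw [← Finset.mul_sum, ← Finset.mul_sum]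
    rw [hd3] at hconj
    linear_combination sigmaConst n s * hconj + sigmaConst n s * z ^ s * heq
  · have hb2 : (Module.finrank ℝ (EuclideanSpace ℝ (Fin n)) : ℝ) / 2 < b := by linarith
    have hlim := (tendsto_integral_scaled hu hM hb2 x).const_mul (sigmaConst n s)
    have hone : sigmaConst n s *
        ((∫ w : EuclideanSpace ℝ (Fin n), (1 + ‖w‖ ^ 2) ^ (-b)) * u x) = u x := by
      have h1 : 0 < Gamma (s / 2) := Gamma_pos_of_pos (by positivity)
      have h2 : 0 < Gamma b := Gamma_pos_of_pos (by positivity)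
      have h3 : (0 : ℝ) < π ^ ((n : ℝ) / 2) := by positivity
      rw [integral_one_add_norm_sq_rpow_neg hb2, hfin,
        show b - (n : ℝ) / 2 = s / 2 by rw [hbdef]; ring, sigmaConst, ← hbdef]
      field_simp
    rw [hone] at hlim
    refine (hlim.mono_left nhdsWithin_le_nhds).congr' ?_
    filter_upwards [self_mem_nhdsWithin] with z hz
    have hz' : 0 < z := hz
    simp_rw [hU, hker]
    rw [integral_const_mul, integral_translate_eq_integral_scaled b x hz', hfin, mul_assoc,
      ← mul_assoc (z ^ s), ← rpow_add hz', show s + ((n : ℝ) - 2 * b) = 0 by rw [hbdef]; ring,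
      rpow_zero, one_mul]
end

section
/- Let n ≥ 1 be an integer, s ∈ (0,2), and let u : ℝⁿ → ℝ be a Schwartz function. Let U(x,z) := ∫_{ℝⁿ} P_s(x−y, z) u(y) dy be its Poisson extension. Then for every x ∈ ℝⁿ: (a) the principal value (−Δ)^{s/2}u(x) := lim_{δ→0⁺} ∫_{{|y−x|>δ}} (u(x) − u(y)) · α_{n,s}/|x−y|^{n+s} dy exists; and (b) lim_{z→0⁺} z^{1−s} ∂_z U(x,z) = −β_s^{−1} · (−Δ)^{s/2} u(x), where β_s := 2^{s−1} Γ(s/2)/Γ(1−s/2). -/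
open MeasureTheory Real Set Filter Topology

/-- `α_{n,s} = s 2^{s-1} Γ((n+s)/2) / (π^{n/2} Γ(1-s/2))`. -/
noncomputable def alphaConst (n : ℕ) (s : ℝ) : ℝ :=
  s * 2 ^ (s - 1) * Real.Gamma (((n : ℝ) + s) / 2) /
    (Real.pi ^ ((n : ℝ) / 2) * Real.Gamma (1 - s / 2))

/-- `β_s = 2^{s-1} Γ(s/2) / Γ(1-s/2)`. -/
noncomputable def betaConst (s : ℝ) : ℝ :=
  2 ^ (s - 1) * Real.Gamma (s / 2) / Real.Gamma (1 - s / 2)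

open Module

/-- The centred symmetric average of `u` around `x`, minus the value at `x`. -/
noncomputable def symmDiffAvg {E : Type*} [AddCommGroup E] (u : E → ℝ) (x h : E) : ℝ :=
  (u (x + h) + u (x - h)) / 2 - u x

lemma SchwartzMap.exists_abs_symmDiffAvg_le {E : Type*} [NormedAddCommGroup E] [NormedSpace ℝ E]
    (u : SchwartzMap E ℝ) (x : E) :
    ∃ C : ℝ, 0 ≤ C ∧ ∀ h, |symmDiffAvg u x h| ≤ C * min 1 (‖h‖ ^ 2) := by
  obtain ⟨A, hA⟩ : ∃ A, ∀ y, ‖u y‖ ≤ A := ⟨_, SchwartzMap.norm_le_seminorm ℝ u⟩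
  set v := SchwartzMap.fderivCLM ℝ E ℝ u with hv
  obtain ⟨B, hB⟩ : ∃ B, ∀ y, ‖fderiv ℝ v y‖ ≤ B :=
    ⟨_, fun y => SchwartzMap.norm_le_seminorm ℝ (SchwartzMap.fderivCLM ℝ E _ v) y⟩
  have hA0 : 0 ≤ A := (norm_nonneg _).trans (hA 0)
  have hB0 : 0 ≤ B := (norm_nonneg (fderiv ℝ v 0)).trans (hB 0)
  have hlip (a b : E) : ‖v a - v b‖ ≤ B * ‖a - b‖ :=
    convex_univ.norm_image_sub_le_of_norm_hasFDerivWithin_le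
      (fun y _ => (v.hasFDerivAt y).hasFDerivWithinAt) (fun y _ => hB y) (mem_univ _) (mem_univ _)
  have hsq (h : E) : |symmDiffAvg u x h| ≤ B * ‖h‖ ^ 2 := by
    have hd (y : E) : HasFDerivAt (fun k => u (x + k) + u (x - k)) (v (x + y) - v (x - y)) y := by
      have h1 := (u.hasFDerivAt (x + y)).comp y ((hasFDerivAt_id y).const_add x)
      have h2 := (u.hasFDerivAt (x - y)).comp y ((hasFDerivAt_id y).const_sub x)
      refine (h1.add h2).congr_fderiv ?_
      ext k
      simp [hv, SchwartzMap.fderivCLM_apply, sub_eq_add_neg]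
    have hmv := (convex_closedBall (0 : E) ‖h‖).norm_image_sub_le_of_norm_hasFDerivWithin_le
      (C := 2 * B * ‖h‖) (x := 0) (y := h) (fun y _ => (hd y).hasFDerivWithinAt)
      (fun y hy => by
        refine (hlip _ _).trans ?_
        have : x + y - (x - y) = (2 : ℝ) • y := by rw [two_smul]; abel
        rw [this, norm_smul, Real.norm_eq_abs, abs_two]
        have : ‖y‖ ≤ ‖h‖ := by simpa using hy
        nlinarith [mul_le_mul_of_nonneg_left this hB0])
      (by simp) (by simp)
    simp only [add_zero, sub_zero, Real.norm_eq_abs] at hmv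
    have heq : symmDiffAvg u x h = (u (x + h) + u (x - h) - (u x + u x)) / 2 := by
      unfold symmDiffAvg; ring
    rw [heq, abs_div, abs_two]
    linarith
  have hbd (h : E) : |symmDiffAvg u x h| ≤ 2 * A := by
    have h1 := abs_le.1 (hA (x + h))
    have h2 := abs_le.1 (hA (x - h))
    have h3 := abs_le.1 (hA x)
    unfold symmDiffAvg
    exact abs_le.2 ⟨by linarith, by linarith⟩
  refine ⟨2 * A + B, by positivity, fun h => ?_⟩
  rcases min_cases 1 (‖h‖ ^ 2) with ⟨hm, -⟩ | ⟨hm, -⟩ <;> rw [hm]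
  · linarith [hbd h]
  · nlinarith [hsq h, mul_nonneg hA0 (sq_nonneg ‖h‖)]

section Dominated

variable {E : Type*} [NormedAddCommGroup E]

lemma norm_sq_add_sq_rpow_mul_min_le {q : ℝ} (hq : 0 < q) (z : ℝ) (y : E) :
    (‖y‖ ^ 2 + z ^ 2) ^ (-q) * min 1 (‖y‖ ^ 2) ≤ min 1 (‖y‖ ^ 2) * ‖y‖ ^ (-(2 * q)) := by
  rcases eq_or_ne y 0 with rfl | hy
  · simp
  · have hy0 : 0 < ‖y‖ := norm_pos_iff.2 hy
    have h1 : (‖y‖ ^ 2 + z ^ 2) ^ (-q) ≤ (‖y‖ ^ 2) ^ (-q) :=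
      rpow_le_rpow_of_nonpos (by positivity) (by nlinarith [sq_nonneg z]) (by linarith)
    have h2 : (‖y‖ ^ 2) ^ (-q) = ‖y‖ ^ (-(2 * q)) := by
      rw [← rpow_natCast, ← rpow_mul hy0.le]
      congr 1
      push_cast
      ring
    rw [mul_comm, ← h2]
    gcongr

variable {w : E → ℝ} {C q : ℝ}

lemma norm_sq_add_sq_rpow_mul_le (hC : 0 ≤ C) (hw : ∀ y, |w y| ≤ C * min 1 (‖y‖ ^ 2)) (hq : 0 < q)
    (z : ℝ) (y : E) : ‖(‖y‖ ^ 2 + z ^ 2) ^ (-q) * w y‖ ≤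
      C * (min 1 (‖y‖ ^ 2) * ‖y‖ ^ (-(2 * q))) := by
  rw [norm_mul, Real.norm_of_nonneg (by positivity), Real.norm_eq_abs]
  calc _ ≤ (‖y‖ ^ 2 + z ^ 2) ^ (-q) * (C * min 1 (‖y‖ ^ 2)) :=
        mul_le_mul_of_nonneg_left (hw y) (by positivity)
    _ = C * ((‖y‖ ^ 2 + z ^ 2) ^ (-q) * min 1 (‖y‖ ^ 2)) := by ring
    _ ≤ _ := mul_le_mul_of_nonneg_left (norm_sq_add_sq_rpow_mul_min_le hq z y) hC

variable [MeasurableSpace E] [BorelSpace E] {μ : Measure E}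

lemma tendsto_integral_indicator_norm_rpow_mul (hwc : Continuous w)
    (hw : ∀ y, |w y| ≤ C * min 1 (‖y‖ ^ 2))
    (hg : Integrable (fun y : E => min 1 (‖y‖ ^ 2) * ‖y‖ ^ (-(2 * q))) μ) :
    Tendsto (fun δ : ℝ => ∫ y, {y : E | δ < ‖y‖}.indicator (fun y => ‖y‖ ^ (-(2 * q))) y * w y ∂μ)
      (𝓝[>] 0) (𝓝 (∫ y, ‖y‖ ^ (-(2 * q)) * w y ∂μ)) := by
  refine tendsto_integral_filter_of_dominated_convergence
    (fun y => C * (min 1 (‖y‖ ^ 2) * ‖y‖ ^ (-(2 * q)))) ?_ ?_ (hg.const_mul C) ?_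
  · refine Eventually.of_forall fun δ => Measurable.aestronglyMeasurable ?_
    exact (Measurable.indicator (by fun_prop)
      (measurableSet_lt measurable_const measurable_norm)).mul hwc.measurable
  · refine Eventually.of_forall fun δ => ae_of_all _ fun y => ?_
    rw [norm_mul]
    calc _ ≤ ‖y‖ ^ (-(2 * q)) * (C * min 1 (‖y‖ ^ 2)) := by
          gcongr
          · refine (norm_indicator_le_norm_self _ _).trans_eq ?_
            exact Real.norm_of_nonneg (by positivity)
          · exact hw y
      _ = _ := by ring
  · refine ae_of_all _ fun y => ?_
    rcases eq_or_ne y 0 with rfl | hy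
    · have : w 0 = 0 := by simpa using hw 0
      simp [this]
    · refine tendsto_const_nhds.congr' ?_
      filter_upwards [Ioo_mem_nhdsGT (norm_pos_iff.2 hy)] with δ hδ
      rw [indicator_of_mem (show y ∈ {y : E | δ < ‖y‖} from hδ.2)]

lemma tendsto_integral_norm_sq_add_sq_rpow_mul (hwc : Continuous w) (hC : 0 ≤ C)
    (hw : ∀ y, |w y| ≤ C * min 1 (‖y‖ ^ 2)) (hq : 0 < q)
    (hg : Integrable (fun y : E => min 1 (‖y‖ ^ 2) * ‖y‖ ^ (-(2 * q))) μ) :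
    Tendsto (fun z : ℝ => ∫ y, (‖y‖ ^ 2 + z ^ 2) ^ (-q) * w y ∂μ)
      (𝓝[>] 0) (𝓝 (∫ y, ‖y‖ ^ (-(2 * q)) * w y ∂μ)) := by
  refine tendsto_integral_filter_of_dominated_convergence
    (fun y => C * (min 1 (‖y‖ ^ 2) * ‖y‖ ^ (-(2 * q)))) ?_ ?_ (hg.const_mul C) ?_
  · exact Eventually.of_forall fun z => Measurable.aestronglyMeasurable (by fun_prop)
  · exact Eventually.of_forall fun z => ae_of_all _ (norm_sq_add_sq_rpow_mul_le hC hw hq z)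
  · refine ae_of_all _ fun y => ?_
    rcases eq_or_ne y 0 with rfl | hy
    · have : w 0 = 0 := by simpa using hw 0
      simp [this]
    · have hy0 : 0 < ‖y‖ := norm_pos_iff.2 hy
      have h2 : ‖y‖ ^ (-(2 * q)) = (‖y‖ ^ 2 + 0 ^ 2) ^ (-q) := by
        rw [zero_pow two_ne_zero, add_zero, ← rpow_natCast, ← rpow_mul hy0.le]
        congr 1
        push_cast
        ring
      rw [h2]
      have hc : ContinuousAt (fun z : ℝ => (‖y‖ ^ 2 + z ^ 2) ^ (-q)) 0 :=
        ContinuousAt.rpow_const (by fun_prop) (Or.inl (by positivity))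
      exact (hc.tendsto.mono_left nhdsWithin_le_nhds).mul_const _

lemma hasDerivAt_integral_norm_sq_add_sq_rpow_mul (hwc : Continuous w) (hC : 0 ≤ C)
    (hw : ∀ y, |w y| ≤ C * min 1 (‖y‖ ^ 2)) (hq : 0 < q)
    (hg : Integrable (fun y : E => min 1 (‖y‖ ^ 2) * ‖y‖ ^ (-(2 * q))) μ) {z : ℝ} (hz : 0 < z) :
    HasDerivAt (fun z : ℝ => ∫ y, (‖y‖ ^ 2 + z ^ 2) ^ (-q) * w y ∂μ)
      (∫ y, -(2 * q) * (z / (‖y‖ ^ 2 + z ^ 2)) * ((‖y‖ ^ 2 + z ^ 2) ^ (-q) * w y) ∂μ) z := by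
  refine (hasDerivAt_integral_of_dominated_loc_of_deriv_le (s := Ioi (z / 2))
    (F' := fun z y => -(2 * q) * (z / (‖y‖ ^ 2 + z ^ 2)) * ((‖y‖ ^ 2 + z ^ 2) ^ (-q) * w y))
    (bound := fun y => 2 * q * (2 / z) * (C * (min 1 (‖y‖ ^ 2) * ‖y‖ ^ (-(2 * q)))))
    (Ioi_mem_nhds (by linarith)) ?_ ?_ ?_ ?_ ((hg.const_mul C).const_mul _) ?_).2
  · exact Eventually.of_forall fun z => Measurable.aestronglyMeasurable (by fun_prop)
  · exact (hg.const_mul C).mono' (Measurable.aestronglyMeasurable (by fun_prop))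
      (ae_of_all _ (norm_sq_add_sq_rpow_mul_le hC hw hq z))
  · exact Measurable.aestronglyMeasurable (by fun_prop)
  · refine ae_of_all _ fun y t ht => ?_
    have ht : z / 2 < t := ht
    have ht0 : 0 < t := by linarith
    rw [norm_mul, norm_mul, norm_neg, Real.norm_of_nonneg (by positivity : 0 ≤ 2 * q),
      Real.norm_of_nonneg (by positivity : 0 ≤ t / (‖y‖ ^ 2 + t ^ 2))]
    have h1 : t / (‖y‖ ^ 2 + t ^ 2) ≤ 2 / z := by
      rw [div_le_div_iff₀ (by positivity) hz]
      nlinarith [sq_nonneg ‖y‖]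
    gcongr
    exact norm_sq_add_sq_rpow_mul_le hC hw hq t y
  · refine ae_of_all _ fun y t ht => ?_
    have ht : z / 2 < t := ht
    have ht0 : 0 < t := by linarith
    have hpos : 0 < ‖y‖ ^ 2 + t ^ 2 := by positivity
    have hb : HasDerivAt (fun t : ℝ => ‖y‖ ^ 2 + t ^ 2) (2 * t) t := by
      simpa using (hasDerivAt_pow 2 t).const_add (‖y‖ ^ 2)
    refine ((hb.rpow_const (p := -q) (Or.inl hpos.ne')).mul_const (w y)).congr_deriv ?_
    rw [rpow_sub_one hpos.ne']
    field_simp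

lemma tendsto_integral_div_mul_norm_sq_add_sq_rpow_mul (hwc : Continuous w) (hC : 0 ≤ C)
    (hw : ∀ y, |w y| ≤ C * min 1 (‖y‖ ^ 2)) (hq : 0 < q)
    (hg : Integrable (fun y : E => min 1 (‖y‖ ^ 2) * ‖y‖ ^ (-(2 * q))) μ) :
    Tendsto (fun z : ℝ => z *
        ∫ y, -(2 * q) * (z / (‖y‖ ^ 2 + z ^ 2)) * ((‖y‖ ^ 2 + z ^ 2) ^ (-q) * w y) ∂μ)
      (𝓝[>] 0) (𝓝 0) := by
  simp only [← integral_const_mul]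
  rw [show (0 : ℝ) = ∫ _ : E, (0 : ℝ) ∂μ by simp]
  refine tendsto_integral_filter_of_dominated_convergence
    (fun y => 2 * q * (C * (min 1 (‖y‖ ^ 2) * ‖y‖ ^ (-(2 * q))))) ?_ ?_
    ((hg.const_mul C).const_mul _) ?_
  · exact Eventually.of_forall fun z => Measurable.aestronglyMeasurable (by fun_prop)
  · filter_upwards [self_mem_nhdsWithin] with z hz
    have hz : 0 < z := by simpa using hz
    refine ae_of_all _ fun y => ?_
    rw [← mul_assoc, norm_mul]
    have h1 : ‖z * (-(2 * q) * (z / (‖y‖ ^ 2 + z ^ 2)))‖ ≤ 2 * q := by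
      have h2 : z ^ 2 / (‖y‖ ^ 2 + z ^ 2) ≤ 1 :=
        div_le_one_of_le₀ (by nlinarith [sq_nonneg ‖y‖]) (by positivity)
      rw [show z * (-(2 * q) * (z / (‖y‖ ^ 2 + z ^ 2))) =
        -(2 * q * (z ^ 2 / (‖y‖ ^ 2 + z ^ 2))) by ring, norm_neg,
        Real.norm_of_nonneg (by positivity)]
      nlinarith
    gcongr
    exact norm_sq_add_sq_rpow_mul_le hC hw hq z y
  · refine ae_of_all _ fun y => ?_
    rcases eq_or_ne y 0 with rfl | hy
    · have : w 0 = 0 := by simpa using hw 0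
      simp [this]
    · have hy0 : 0 < ‖y‖ := norm_pos_iff.2 hy
      have hc1 : ContinuousAt (fun z : ℝ => (‖y‖ ^ 2 + z ^ 2) ^ (-q)) 0 :=
        ContinuousAt.rpow_const (by fun_prop) (Or.inl (by positivity))
      have hc2 : ContinuousAt (fun z : ℝ => z / (‖y‖ ^ 2 + z ^ 2)) 0 :=
        ContinuousAt.div (by fun_prop) (by fun_prop) (by positivity)
      have hc : ContinuousAt (fun z : ℝ =>
          z * (-(2 * q) * (z / (‖y‖ ^ 2 + z ^ 2)) * ((‖y‖ ^ 2 + z ^ 2) ^ (-q) * w y))) 0 :=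
        continuousAt_id.mul ((continuousAt_const.mul hc2).mul (hc1.mul continuousAt_const))
      simpa using hc.tendsto.mono_left nhdsWithin_le_nhds

end Dominated

lemma norm_smul_sq_add_sq_rpow {E : Type*} [NormedAddCommGroup E] [NormedSpace ℝ E] {z : ℝ}
    (hz : 0 < z) (r : ℝ) (y : E) :
    (‖z • y‖ ^ 2 + z ^ 2) ^ (-(r / 2)) = z ^ (-r) * (1 + ‖y‖ ^ 2) ^ (-r / 2) := by
  rw [norm_smul, Real.norm_of_nonneg hz.le,
    show (z * ‖y‖) ^ 2 + z ^ 2 = z ^ 2 * (1 + ‖y‖ ^ 2) by ring,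
    mul_rpow (by positivity) (by positivity), ← rpow_natCast z 2, ← rpow_mul hz.le]
  congr 2 <;> push_cast <;> ring

section Kernel

variable {E : Type*} [NormedAddCommGroup E] [NormedSpace ℝ E] [FiniteDimensional ℝ E]
  [MeasurableSpace E] [BorelSpace E] (μ : Measure E) [μ.IsAddHaarMeasure]

lemma integrable_min_one_sq_mul_norm_rpow [Nontrivial E] {s : ℝ} (hs : s ∈ Ioo (0 : ℝ) 2) :
    Integrable (fun y : E => min 1 (‖y‖ ^ 2) * ‖y‖ ^ (-((finrank ℝ E : ℝ) + s))) μ := by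
  have hd : 1 ≤ finrank ℝ E := finrank_pos
  refine (integrable_fun_norm_addHaar μ
    (f := fun r : ℝ => min 1 (r ^ 2) * r ^ (-((finrank ℝ E : ℝ) + s)))).2 ?_
  have hpow (r : ℝ) (hr : 0 < r) :
      r ^ (finrank ℝ E - 1) * r ^ (-((finrank ℝ E : ℝ) + s)) = r ^ (-1 - s) := by
    rw [← rpow_natCast, ← rpow_add hr, Nat.cast_sub hd]
    congr 1
    push_cast
    ring
  rw [← Ioc_union_Ioi_eq_Ioi (zero_le_one' ℝ)]
  refine IntegrableOn.union ?_ ?_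
  · have h1 : IntegrableOn (fun r : ℝ => r ^ (1 - s)) (Ioc 0 1) :=
      (intervalIntegrable_iff_integrableOn_Ioc_of_le zero_le_one).1
        (intervalIntegral.intervalIntegrable_rpow' (by linarith [hs.2]))
    refine h1.congr_fun (fun r hr => ?_) measurableSet_Ioc
    have hm : min 1 (r ^ 2) = r ^ 2 := min_eq_right (by nlinarith [hr.1, hr.2])
    simp only [hm, smul_eq_mul]
    rw [mul_left_comm, hpow r hr.1, ← rpow_natCast, ← rpow_add hr.1]
    congr 1
    push_cast
    ring
  · have h1 : IntegrableOn (fun r : ℝ => r ^ (-1 - s)) (Ioi 1) :=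
      integrableOn_Ioi_rpow_of_lt (by linarith [hs.1]) one_pos
    refine h1.congr_fun (fun r hr => ?_) measurableSet_Ioi
    have hr1 : 1 < r := hr
    have hm : min 1 (r ^ 2) = 1 := min_eq_left (by nlinarith)
    simp only [hm, smul_eq_mul, one_mul]
    rw [hpow r (by linarith)]

lemma integrable_indicator_norm_rpow_neg {r δ : ℝ} (hr : (finrank ℝ E : ℝ) < r) (hδ : 0 < δ) :
    Integrable ({y : E | δ < ‖y‖}.indicator fun y => ‖y‖ ^ (-r)) μ := by
  have hr0 : 0 < r := (Nat.cast_nonneg _).trans_lt hr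
  have hmeas : MeasurableSet {y : E | δ < ‖y‖} := measurableSet_lt measurable_const measurable_norm
  refine ((integrable_one_add_norm (μ := μ) hr).const_mul ((1 / δ + 1) ^ r)).mono'
    (Measurable.indicator (by fun_prop) hmeas).aestronglyMeasurable (ae_of_all _ fun y => ?_)
  by_cases hy : δ < ‖y‖
  · have hy0 : 0 < ‖y‖ := hδ.trans hy
    rw [indicator_of_mem (show y ∈ {y : E | δ < ‖y‖} from hy), Real.norm_of_nonneg (by positivity)]
    have h1 : 1 + ‖y‖ ≤ (1 / δ + 1) * ‖y‖ := by
      have : 1 ≤ 1 / δ * ‖y‖ := by rw [one_div_mul_eq_div, one_le_div hδ]; exact hy.le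
      linarith
    have h2 := rpow_le_rpow_of_nonpos (by positivity) h1 (neg_nonpos.2 hr0.le)
    rw [mul_rpow (by positivity) (by positivity), rpow_neg (by positivity : 0 ≤ 1 / δ + 1)] at h2
    have h3 : 0 < (1 / δ + 1) ^ r := by positivity
    rwa [inv_mul_le_iff₀ h3] at h2
  · rw [indicator_of_notMem (show y ∉ {y : E | δ < ‖y‖} from hy), norm_zero]
    positivity

lemma integrable_norm_sq_add_sq_rpow {r z : ℝ} (hr : (finrank ℝ E : ℝ) < r) (hz : 0 < z) :
    Integrable (fun y : E => (‖y‖ ^ 2 + z ^ 2) ^ (-(r / 2))) μ := by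
  rw [← integrable_comp_smul_iff μ _ hz.ne']
  simp only [norm_smul_sq_add_sq_rpow hz]
  exact (integrable_rpow_neg_one_add_norm_sq hr).const_mul _

lemma rpow_mul_integral_norm_sq_add_sq_rpow (s : ℝ) {z : ℝ} (hz : 0 < z) :
    z ^ s * ∫ y : E, (‖y‖ ^ 2 + z ^ 2) ^ (-(((finrank ℝ E : ℝ) + s) / 2)) ∂μ =
      ∫ y : E, (1 + ‖y‖ ^ 2) ^ (-((finrank ℝ E : ℝ) + s) / 2) ∂μ := by
  have h := Measure.integral_comp_smul_of_nonneg μ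
    (fun y : E => (‖y‖ ^ 2 + z ^ 2) ^ (-(((finrank ℝ E : ℝ) + s) / 2))) z (hR := hz.le)
  simp only [norm_smul_sq_add_sq_rpow hz, smul_eq_mul, integral_const_mul] at h
  rw [neg_add, rpow_add hz, rpow_neg hz.le, rpow_neg hz.le, rpow_natCast, mul_assoc] at h
  have h2 := mul_left_cancel₀ (inv_ne_zero (pow_ne_zero _ hz.ne')) h
  rw [← h2, mul_inv_cancel_left₀ (rpow_pos_of_pos hz s).ne', neg_add]

lemma integral_mul_sub_eq_integral_mul_symmDiffAvg {k u : E → ℝ} (hk : Integrable k μ)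
    (hkeven : ∀ y, k (-y) = k y) (hu : Continuous u) {A : ℝ} (hA : ∀ y, ‖u y‖ ≤ A) (x : E) :
    ∫ y, k y * (u (x + y) - u x) ∂μ = ∫ y, k y * symmDiffAvg u x y ∂μ := by
  have hbd (y : E) : ‖u (x + y) - u x‖ ≤ A + A := (norm_sub_le _ _).trans (add_le_add (hA _) (hA _))
  have hi : Integrable (fun y => k y * (u (x + y) - u x)) μ :=
    hk.mul_bdd (by fun_prop) (ae_of_all _ hbd)
  have hneg := integral_neg_eq_self (fun y => k y * (u (x + y) - u x)) μ
  have hsum := integral_add hi hi.comp_neg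
  rw [hneg] at hsum
  have hpt (y : E) : k y * symmDiffAvg u x y =
      (k y * (u (x + y) - u x) + k (-y) * (u (x + -y) - u x)) / 2 := by
    rw [hkeven, symmDiffAvg, sub_eq_add_neg x y]
    ring
  simp only [hpt]
  rw [integral_div, hsum]
  ring

end Kernel

lemma inv_betaConst_mul_alphaConst (n : ℕ) {s : ℝ} (hs : s ∈ Ioo (0 : ℝ) 2) :
    (betaConst s)⁻¹ * alphaConst n s = sigmaConst n s * s := by
  have h1 : 0 < Real.Gamma (s / 2) := Real.Gamma_pos_of_pos (by linarith [hs.1])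
  have h2 : 0 < Real.Gamma (1 - s / 2) := Real.Gamma_pos_of_pos (by linarith [hs.2])
  have h3 : 0 < (2 : ℝ) ^ (s - 1) := by positivity
  have h4 : 0 < Real.pi ^ ((n : ℝ) / 2) := by positivity
  unfold betaConst alphaConst sigmaConst
  generalize Real.Gamma (1 - s / 2) = a at *
  field_simp

/-- Dirichlet-to-Neumann identity for the Euclidean Poisson extension of a Schwartz
function: the principal value defining `(-Δ)^{s/2}u(x)` exists, and
`lim_{z→0⁺} z^{1-s} ∂_z U(x,z) = -β_s⁻¹ (-Δ)^{s/2} u(x)`. -/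
theorem dirichlet_to_neumann (n : ℕ) (hn : 1 ≤ n) (s : ℝ) (hs : s ∈ Ioo (0:ℝ) 2)
    (u : SchwartzMap (EuclideanSpace ℝ (Fin n)) ℝ)
    (U : EuclideanSpace ℝ (Fin n) → ℝ → ℝ)
    (hU : ∀ x z, U x z =
      ∫ y, sigmaConst n s * z ^ s / (‖x - y‖ ^ 2 + z ^ 2) ^ (((n : ℝ) + s) / 2) * u y)
    (x : EuclideanSpace ℝ (Fin n)) :
    ∃ L : ℝ,
      Tendsto
        (fun δ : ℝ => ∫ y in {y : EuclideanSpace ℝ (Fin n) | δ < ‖y - x‖},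
          (u x - u y) * (alphaConst n s / ‖x - y‖ ^ ((n : ℝ) + s)))
        (𝓝[>] (0:ℝ)) (𝓝 L) ∧
      Tendsto (fun z : ℝ => z ^ (1 - s) * deriv (fun w : ℝ => U x w) z)
        (𝓝[>] (0:ℝ)) (𝓝 (-(betaConst s)⁻¹ * L)) := by
  have : Nonempty (Fin n) := ⟨⟨0, hn⟩⟩
  have hdim : finrank ℝ (EuclideanSpace ℝ (Fin n)) = n := by simp
  set q : ℝ := ((n : ℝ) + s) / 2 with hq_def
  have h2q : 2 * q = (n : ℝ) + s := by rw [hq_def]; ring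
  have hs0 : 0 < s := hs.1
  have hq : 0 < q := by positivity
  have hr : (finrank ℝ (EuclideanSpace ℝ (Fin n)) : ℝ) < (n : ℝ) + s := by rw [hdim]; linarith
  obtain ⟨C, hC, hw⟩ := u.exists_abs_symmDiffAvg_le x
  set w := symmDiffAvg u x
  have huc : Continuous u := u.continuous
  have hwc : Continuous w := by unfold w symmDiffAvg; fun_prop
  have hg := integrable_min_one_sq_mul_norm_rpow (volume : Measure (EuclideanSpace ℝ (Fin n))) hs
  rw [hdim, ← h2q] at hg
  have hA := SchwartzMap.norm_le_seminorm ℝ u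
  set I := ∫ y : EuclideanSpace ℝ (Fin n), ‖y‖ ^ (-(2 * q)) * w y
  refine ⟨-alphaConst n s * I, ?_, ?_⟩
  · refine ((tendsto_integral_indicator_norm_rpow_mul hwc hw hg).const_mul
      (-alphaConst n s)).congr' ?_
    filter_upwards [self_mem_nhdsWithin] with δ hδ
    have hδ : 0 < δ := by simpa using hδ
    symm
    rw [← integral_indicator (measurableSet_lt measurable_const (by fun_prop)),
      ← integral_add_left_eq_self _ x, ← integral_mul_sub_eq_integral_mul_symmDiffAvg volume
        (by rw [h2q]; exact integrable_indicator_norm_rpow_neg _ hr hδ) (by simp [indicator]) huc hA x,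
      ← integral_const_mul]
    refine integral_congr_ae (ae_of_all _ fun y => ?_)
    by_cases hy : δ < ‖y‖
    · have hneg : ‖y‖ ^ (-(2 * q)) = (‖y‖ ^ ((n : ℝ) + s))⁻¹ := by
        rw [h2q, rpow_neg (norm_nonneg y)]
      simp [indicator, hy, hneg]
      ring
    · simp [indicator, hy]
  · set M := ∫ y : EuclideanSpace ℝ (Fin n), (1 + ‖y‖ ^ 2) ^ (-((n : ℝ) + s) / 2) with hM
    have hUeq (z : ℝ) (hz : 0 < z) : U x z =
        sigmaConst n s * (M * u x + z ^ s *
          ∫ y : EuclideanSpace ℝ (Fin n), (‖y‖ ^ 2 + z ^ 2) ^ (-q) * w y) := by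
      have hk := integrable_norm_sq_add_sq_rpow
        (volume : Measure (EuclideanSpace ℝ (Fin n))) hr hz
      have hmass := rpow_mul_integral_norm_sq_add_sq_rpow
        (volume : Measure (EuclideanSpace ℝ (Fin n))) s hz
      rw [hdim, ← hq_def] at hmass
      rw [← hq_def] at hk
      rw [← integral_mul_sub_eq_integral_mul_symmDiffAvg volume hk (by simp) huc hA x, hM, ← hmass,
        hU, ← integral_add_left_eq_self _ x]
      have hku : Integrable (fun y => (‖y‖ ^ 2 + z ^ 2) ^ (-q) * u (x + y)) :=
        hk.mul_bdd (by fun_prop) (ae_of_all _ fun y => hA _)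
      simp only [mul_sub]
      rw [integral_sub hku (hk.mul_const _), integral_mul_const]
      have hpt (y : EuclideanSpace ℝ (Fin n)) :
          sigmaConst n s * z ^ s / (‖x - (x + y)‖ ^ 2 + z ^ 2) ^ q * u (x + y) =
            sigmaConst n s * z ^ s * ((‖y‖ ^ 2 + z ^ 2) ^ (-q) * u (x + y)) := by
        rw [rpow_neg (by positivity), sub_add_cancel_left, norm_neg]
        ring
      simp only [hpt, integral_const_mul]
      ring
    have hlim := (((tendsto_integral_norm_sq_add_sq_rpow_mul hwc hC hw hq hg).const_mul s).add
      (tendsto_integral_div_mul_norm_sq_add_sq_rpow_mul hwc hC hw hq hg)).const_mul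
      (sigmaConst n s)
    have hval : -(betaConst s)⁻¹ * (-alphaConst n s * I) = sigmaConst n s * (s * I + 0) := by
      linear_combination I * inv_betaConst_mul_alphaConst n hs
    rw [hval]
    refine hlim.congr' ?_
    filter_upwards [self_mem_nhdsWithin] with z hz
    have hz : 0 < z := by simpa using hz
    have hev : (fun z => U x z) =ᶠ[𝓝 z] fun z => sigmaConst n s * (M * u x + z ^ s *
        ∫ y : EuclideanSpace ℝ (Fin n), (‖y‖ ^ 2 + z ^ 2) ^ (-q) * w y) := by
      filter_upwards [Ioi_mem_nhds hz] with t ht using hUeq t ht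
    have hder : HasDerivAt (fun z => sigmaConst n s * (M * u x + z ^ s *
        ∫ y : EuclideanSpace ℝ (Fin n), (‖y‖ ^ 2 + z ^ 2) ^ (-q) * w y)) _ z :=
      (((hasDerivAt_rpow_const (p := s) (Or.inl hz.ne')).mul
      (hasDerivAt_integral_norm_sq_add_sq_rpow_mul hwc hC hw hq hg hz)).const_add
      (M * u x)).const_mul (sigmaConst n s)
    rw [hev.deriv_eq, hder.deriv, rpow_sub hz, rpow_sub hz, rpow_one]
    have hzs : 0 < z ^ s := by positivity
    field_simp
end

section
/- Let n ≥ 1 be an integer, s ∈ (0,2), and let u : ℝⁿ → ℝ be a Schwartz function. Let U(x,z) := ∫_{ℝⁿ} P_s(x−y, z) u(y) dy be its Poisson extension. Then ∬_{ℝⁿ×ℝⁿ} α_{n,s} (u(x) − u(y))² / |x−y|^{n+s} dx dy = 2 β_s ∫_{ℝⁿ×(0,∞)} z^{1−s} (|∇_x U(x,z)|² + (∂_z U(x,z))²) dx dz, where β_s := 2^{s−1} Γ(s/2)/Γ(1−s/2). -/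
open MeasureTheory Real Set

open scoped ENNReal FourierTransform LineDeriv

theorem integrableOn_rpow_mul_exp_neg_div {e A : ℝ} (he : 0 < e) (hA : 0 < A) :
    IntegrableOn (fun t : ℝ => t ^ (-e - 1) * exp (-(A / t))) (Ioi 0) := by
  have h := (integrableOn_Ioi_comp_rpow_iff' (fun t : ℝ => t ^ (e - 1) * exp (-(A * t)))
    (p := -1) (by norm_num)).2 (by
      have := integrableOn_rpow_mul_exp_neg_mul_rpow (s := e - 1) (p := 1) (b := A)
        (by linarith) one_pos hA
      simpa using this)
  refine h.congr_fun (fun t (ht : 0 < t) => ?_) measurableSet_Ioi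
  simp only [smul_eq_mul]
  rw [← rpow_mul ht.le, ← mul_assoc, ← rpow_add ht, rpow_neg_one, div_eq_mul_inv]
  ring_nf

theorem integral_rpow_mul_exp_neg_div {e A : ℝ} (he : 0 < e) (hA : 0 < A) :
    ∫ t in Ioi (0 : ℝ), t ^ (-e - 1) * exp (-(A / t)) = Real.Gamma e * A ^ (-e) := by
  have h := integral_comp_rpow_Ioi (fun t : ℝ => t ^ (e - 1) * exp (-(A * t)))
    (p := -1) (by norm_num)
  rw [integral_rpow_mul_exp_neg_mul_Ioi he hA] at h
  rw [rpow_neg hA.le, ← inv_rpow hA.le, mul_comm, ← one_div, ← h]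
  refine setIntegral_congr_fun measurableSet_Ioi (fun t (ht : 0 < t) => ?_)
  simp only [smul_eq_mul, abs_neg, abs_one, one_mul]
  rw [← rpow_mul ht.le, ← mul_assoc, ← rpow_add ht, rpow_neg_one, div_eq_mul_inv]
  ring_nf

theorem integrableOn_rpow_mul_exp_neg_mul {e A : ℝ} (he : 0 < e) (hA : 0 < A) :
    IntegrableOn (fun t : ℝ => t ^ (e - 1) * exp (-(A * t))) (Ioi 0) := by
  have := integrableOn_rpow_mul_exp_neg_mul_rpow (s := e - 1) (p := 1) (b := A)
        (by linarith) one_pos hA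
  simpa using this

/-- The Laplace-type integral giving the Fourier multiplier of a power of `‖x‖² + z²`. -/
noncomputable def subordInt (c z b : ℝ) : ℝ :=
  ∫ t in Ioi (0 : ℝ), t ^ (-c - 1) * exp (-(z ^ 2 / t)) * exp (-(b * t))

theorem integrableOn_subord_of_pos {c z b : ℝ} (hc : 0 < c) (hz : 0 < z) (hb : 0 ≤ b) :
    IntegrableOn (fun t : ℝ => t ^ (-c - 1) * exp (-(z ^ 2 / t)) * exp (-(b * t))) (Ioi 0) := by
  refine Integrable.mono' (integrableOn_rpow_mul_exp_neg_div hc (pow_pos hz 2))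
    (by fun_prop) ((ae_restrict_iff' measurableSet_Ioi).2 (.of_forall fun t (ht : 0 < t) => ?_))
  rw [norm_of_nonneg (by positivity)]
  exact mul_le_of_le_one_right (by positivity) (exp_le_one_iff.2 (by nlinarith))

theorem integrableOn_subord_of_neg {c z b : ℝ} (hc : c < 0) (hb : 0 < b) :
    IntegrableOn (fun t : ℝ => t ^ (-c - 1) * exp (-(z ^ 2 / t)) * exp (-(b * t))) (Ioi 0) := by
  refine Integrable.mono' (integrableOn_rpow_mul_exp_neg_mul (neg_pos.2 hc) hb)
    (by fun_prop) ((ae_restrict_iff' measurableSet_Ioi).2 (.of_forall fun t (ht : 0 < t) => ?_))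
  rw [norm_of_nonneg (by positivity)]
  gcongr
  exact mul_le_of_le_one_right (by positivity) (exp_le_one_iff.2 (by
    have : 0 ≤ z ^ 2 / t := by positivity
    linarith))

theorem subordInt_recurrence {a z b : ℝ} (ha : a ∈ Ioo (0 : ℝ) 1) (hz : 0 < z) (hb : 0 < b) :
    z ^ 2 * subordInt (a + 1) z b = a * subordInt a z b + b * subordInt (a - 1) z b := by
  obtain ⟨ha0, ha1⟩ := ha
  have i1 := integrableOn_subord_of_pos (c := a + 1) (by linarith) hz hb.le
  have i2 := integrableOn_subord_of_pos ha0 hz hb.le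
  have i3 := integrableOn_subord_of_neg (c := a - 1) (z := z) (by linarith) hb
  set f : ℝ → ℝ := fun t => t ^ (-a) * exp (-(z ^ 2 / t)) * exp (-(b * t)) with hf
  have hd : ∀ t ∈ Ioi (0 : ℝ), HasDerivAt f
      (z ^ 2 * (t ^ (-(a + 1) - 1) * exp (-(z ^ 2 / t)) * exp (-(b * t)))
        - a * (t ^ (-a - 1) * exp (-(z ^ 2 / t)) * exp (-(b * t)))
        - b * (t ^ (-(a - 1) - 1) * exp (-(z ^ 2 / t)) * exp (-(b * t)))) t := by
    intro t (ht : 0 < t)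
    have h1 := hasDerivAt_rpow_const (x := t) (p := -a) (Or.inl ht.ne')
    have h2 : HasDerivAt (fun t : ℝ => exp (-(z ^ 2 / t))) (exp (-(z ^ 2 / t)) * (z ^ 2 / t ^ 2)) t := by
      have := ((hasDerivAt_inv ht.ne').const_mul (z ^ 2)).neg.exp
      simp only [Pi.neg_apply, ← div_eq_mul_inv] at this
      convert! this using 1
      field_simp
    have h3 : HasDerivAt (fun t : ℝ => exp (-(b * t))) (exp (-(b * t)) * -b) t := by
      simpa using ((hasDerivAt_id t).const_mul b).neg.exp
    convert! (h1.mul h2).mul h3 using 1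
    have e1 : t ^ (-(a + 1) - 1) = t ^ (-a) / t ^ 2 := by
      rw [show -(a + 1) - 1 = -a - (2 : ℕ) by push_cast; ring, rpow_sub_natCast ht.ne']
    have e2 : t ^ (-(a - 1) - 1) = t ^ (-a) := by ring_nf
    simp only [Pi.mul_apply]
    rw [e1, e2]
    ring
  have hf0 : Filter.Tendsto f (nhdsWithin 0 (Ioi 0)) (nhds 0) := by
    have h := (tendsto_rpow_mul_exp_neg_mul_atTop_nhds_zero a (z ^ 2) (by positivity)).comp
      tendsto_inv_nhdsGT_zero
    have h' : Filter.Tendsto (fun t : ℝ => exp (-(b * t))) (nhdsWithin 0 (Ioi 0)) (nhds 1) := by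
      have : ContinuousAt (fun t : ℝ => exp (-(b * t))) 0 := by fun_prop
      simpa [ContinuousAt] using this.mono_left nhdsWithin_le_nhds
    refine (by simpa using h.mul h' : Filter.Tendsto _ _ (nhds (0 : ℝ))).congr' ?_
    filter_upwards [self_mem_nhdsWithin] with t (ht : 0 < t)
    simp only [hf, inv_rpow ht.le, rpow_neg ht.le, div_eq_mul_inv]
  have hft : Filter.Tendsto f Filter.atTop (nhds 0) := by
    refine squeeze_zero' (g := fun t => t ^ (-a) * exp (-b * t)) ?_ ?_
      (tendsto_rpow_mul_exp_neg_mul_atTop_nhds_zero _ _ hb)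
    · filter_upwards [Filter.eventually_gt_atTop 0] with t ht
      positivity
    · filter_upwards [Filter.eventually_gt_atTop 0] with t ht
      rw [neg_mul]
      simp only [hf]
      gcongr
      exact mul_le_of_le_one_right (by positivity) (exp_le_one_iff.2 (by
        have : 0 ≤ z ^ 2 / t := by positivity
        linarith))
  have hc : ContinuousWithinAt f (Ici 0) 0 := by
    rw [← continuousWithinAt_Ioi_iff_Ici, ContinuousWithinAt]
    simpa [hf, zero_rpow (neg_ne_zero.2 ha0.ne')] using hf0
  have i12 : IntegrableOn (fun t : ℝ =>
      z ^ 2 * (t ^ (-(a + 1) - 1) * exp (-(z ^ 2 / t)) * exp (-(b * t)))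
        - a * (t ^ (-a - 1) * exp (-(z ^ 2 / t)) * exp (-(b * t)))) (Ioi 0) :=
    (i1.const_mul _).sub (i2.const_mul _)
  have key := integral_Ioi_of_hasDerivAt_of_tendsto hc hd
    (i12.sub (i3.const_mul _)) hft
  rw [integral_sub i12 (i3.const_mul _), integral_sub (i1.const_mul _) (i2.const_mul _)] at key
  have hf00 : f 0 = 0 := by simp [hf, zero_rpow (neg_ne_zero.2 ha0.ne')]
  simp only [integral_const_mul, hf00] at key
  unfold subordInt
  linarith

theorem lintegral_Ioi_Ioi_swap {F : ℝ → ℝ → ℝ≥0∞} (hF : Measurable (Function.uncurry F)) :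
    ∫⁻ t in Ioi 0, ∫⁻ v in Ioi t, F t v = ∫⁻ v in Ioi 0, ∫⁻ t in Ioo 0 v, F t v := by
  have hm : MeasurableSet {p : ℝ × ℝ | 0 < p.1 ∧ p.1 < p.2} :=
    (measurableSet_lt measurable_const measurable_fst).inter
      (measurableSet_lt measurable_fst measurable_snd)
  have hG : Measurable (Function.uncurry fun t v : ℝ =>
      {p : ℝ × ℝ | 0 < p.1 ∧ p.1 < p.2}.indicator (Function.uncurry F) (t, v)) :=
    hF.indicator hm
  have h := lintegral_lintegral_swap (μ := volume) (ν := volume) hG.aemeasurable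
  convert! h using 1
  · rw [← lintegral_indicator measurableSet_Ioi]
    refine lintegral_congr fun t => ?_
    by_cases ht : t ∈ Ioi (0 : ℝ)
    · rw [indicator_of_mem ht, ← lintegral_indicator measurableSet_Ioi]
      refine lintegral_congr fun v => ?_
      simp only [indicator, mem_Ioi, mem_ofPred_eq, Function.uncurry]
      simp [mem_Ioi.1 ht]
    · rw [indicator_of_notMem ht]
      simp only [indicator, mem_ofPred_eq]
      simp [mem_Ioi.not.1 ht]
  · rw [← lintegral_indicator measurableSet_Ioi]
    refine lintegral_congr fun v => ?_
    by_cases hv : v ∈ Ioi (0 : ℝ)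
    · rw [indicator_of_mem hv, ← lintegral_indicator measurableSet_Ioo]
      refine lintegral_congr fun t => ?_
      simp only [indicator, mem_Ioo, mem_ofPred_eq, Function.uncurry]
      congr
    · rw [indicator_of_notMem hv]
      have : ∀ t, ¬ (0 < t ∧ t < v) := fun t ht => hv (ht.1.trans ht.2)
      simp [indicator, this]

theorem lintegral_Ioi_Ioi_comp_add {f : ℝ → ℝ≥0∞} (hf : Measurable f) :
    ∫⁻ t in Ioi 0, ∫⁻ r in Ioi 0, f (t + r) = ∫⁻ v in Ioi 0, ENNReal.ofReal v * f v := by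
  have h : ∀ t : ℝ, ∫⁻ r in Ioi 0, f (t + r) = ∫⁻ v in Ioi t, f v := by
    intro t
    rw [← lintegral_indicator measurableSet_Ioi, ← lintegral_indicator measurableSet_Ioi,
      ← lintegral_add_left_eq_self ((Ioi t).indicator f) t]
    simp [indicator]
  simp_rw [h]
  rw [lintegral_Ioi_Ioi_swap (by fun_prop)]
  refine setLIntegral_congr_fun measurableSet_Ioi fun v _ => ?_
  simp [mul_comm]

theorem lintegral_rpow_mul_exp {e A : ℝ} (he : 0 < e) (hA : 0 < A) :
    ∫⁻ t in Ioi 0, ENNReal.ofReal (t ^ (e - 1) * exp (-(A * t))) =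
      ENNReal.ofReal (Real.Gamma e * A ^ (-e)) := by
  rw [← ofReal_integral_eq_lintegral_ofReal (integrableOn_rpow_mul_exp_neg_mul he hA)
    ((ae_restrict_iff' measurableSet_Ioi).2 (.of_forall fun t (ht : 0 < t) => by
      simp only [Pi.zero_apply]; positivity)), integral_rpow_mul_exp_neg_mul_Ioi he hA,
    one_div, inv_rpow hA.le, rpow_neg hA.le, mul_comm]

theorem lintegral_rpow_mul_one_sub_exp {a b : ℝ} (ha : a ∈ Ioo (0 : ℝ) 1) (hb : 0 < b) :
    ∫⁻ t in Ioi 0, ENNReal.ofReal (t ^ (-a - 1) * (1 - exp (-(b * t)))) =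
      ENNReal.ofReal (b ^ a * Real.Gamma (1 - a) / a) := by
  obtain ⟨ha0, ha1⟩ := ha
  have h1 : ∀ t ∈ Ioi (0 : ℝ), ENNReal.ofReal (t ^ (-a - 1) * (1 - exp (-(b * t)))) =
      ∫⁻ v in Ioo 0 t, ENNReal.ofReal (b * exp (-(b * v)) * t ^ (-a - 1)) := by
    intro t (ht : 0 < t)
    have hcont : Continuous fun v => b * exp (-(b * v)) * t ^ (-a - 1) := by fun_prop
    rw [restrict_Ioo_eq_restrict_Ioc, ← ofReal_integral_eq_lintegral_ofReal
      (hcont.integrableOn_Ioc) (.of_forall fun v => by simp only [Pi.zero_apply]; positivity),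
      ← intervalIntegral.integral_of_le ht.le,
      intervalIntegral.integral_eq_sub_of_hasDerivAt
        (f := fun v => -exp (-(b * v)) * t ^ (-a - 1)) _ (hcont.intervalIntegrable _ _)]
    · congr 1; simp; ring
    · intro v _
      have := ((((hasDerivAt_id v).const_mul b).neg.exp).neg).mul_const (t ^ (-a - 1))
      convert! this using 1
      simp
      left
      ring
  have h2 : ∀ v ∈ Ioi (0 : ℝ),
      ∫⁻ t in Ioi v, ENNReal.ofReal (b * exp (-(b * v)) * t ^ (-a - 1)) =
      ENNReal.ofReal (b / a) * ENNReal.ofReal (v ^ ((1 - a) - 1) * exp (-(b * v))) := by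
    intro v (hv : 0 < v)
    rw [← ofReal_integral_eq_lintegral_ofReal
      ((integrableOn_Ioi_rpow_of_lt (by linarith) hv).const_mul _)
      ((ae_restrict_iff' measurableSet_Ioi).2 (.of_forall fun t (ht : v < t) => by
        have := hv.trans ht
        simp only [Pi.zero_apply]; positivity)), integral_const_mul,
      integral_Ioi_rpow_of_lt (by linarith) hv, ← ENNReal.ofReal_mul (by positivity)]
    congr 1
    rw [show -a - 1 + 1 = -a by ring, show 1 - a - 1 = -a by ring]
    field_simp
  rw [setLIntegral_congr_fun measurableSet_Ioi h1,
    ← lintegral_Ioi_Ioi_swap (F := fun v t => ENNReal.ofReal (b * exp (-(b * v)) * t ^ (-a - 1)))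
      (by fun_prop), setLIntegral_congr_fun measurableSet_Ioi h2,
    lintegral_const_mul _ (by fun_prop), lintegral_rpow_mul_exp (by linarith) hb,
    ← ENNReal.ofReal_mul (by positivity)]
  congr 1
  rw [show -(1 - a) = a - 1 by ring, rpow_sub_one hb.ne']
  field_simp

theorem lintegral_subord_sq {b c : ℝ} (hc : c ∈ Ioo (-1 : ℝ) 1) (hb : 0 < b) :
    ∫⁻ z in Ioi 0, ENNReal.ofReal (z ^ (1 + 2 * c)) *
      (∫⁻ t in Ioi 0, ENNReal.ofReal (t ^ (-c - 1) * exp (-(z ^ 2 / t)) * exp (-(b * t)))) ^ 2 =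
      ENNReal.ofReal (1 / 2 * Real.Gamma (1 + c) * (Real.Gamma (1 - c) * b ^ (c - 1))) := by
  obtain ⟨hc0, hc1⟩ := hc
  let φ : ℝ → ℝ → ℝ≥0∞ := fun z t =>
    ENNReal.ofReal (t ^ (-c - 1) * exp (-(z ^ 2 / t)) * exp (-(b * t)))
  have hφm : Measurable (Function.uncurry φ) := by fun_prop
  have hφm' : ∀ z, Measurable (φ z) := fun z => by fun_prop
  have e1 : ∀ z, ENNReal.ofReal (z ^ (1 + 2 * c)) * (∫⁻ t in Ioi 0, φ z t) ^ 2 =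
      ∫⁻ t in Ioi 0, ∫⁻ r in Ioi 0, ENNReal.ofReal (z ^ (1 + 2 * c)) * φ z t * φ z r := by
    intro z
    simp_rw [lintegral_const_mul _ (hφm' z)]
    rw [lintegral_mul_const _ (by fun_prop), lintegral_const_mul _ (hφm' z)]
    ring
  have e2 : ∀ t ∈ Ioi (0 : ℝ), ∀ r ∈ Ioi (0 : ℝ),
      ∫⁻ z in Ioi 0, ENNReal.ofReal (z ^ (1 + 2 * c)) * φ z t * φ z r =
      ENNReal.ofReal (1 / 2 * Real.Gamma (1 + c) *
        ((t + r) ^ (-(1 + c)) * exp (-(b * (t + r))))) := by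
    intro t (ht : 0 < t) r (hr : 0 < r)
    have hA : 0 < t⁻¹ + r⁻¹ := by positivity
    have e3 : ∀ z ∈ Ioi (0 : ℝ), ENNReal.ofReal (z ^ (1 + 2 * c)) * φ z t * φ z r =
        ENNReal.ofReal ((t ^ (-c - 1) * r ^ (-c - 1) * exp (-(b * (t + r)))) *
          (z ^ (1 + 2 * c) * exp (-(t⁻¹ + r⁻¹) * z ^ (2 : ℝ)))) := by
      intro z (hz : 0 < z)
      simp only [φ]
      rw [← ENNReal.ofReal_mul (by positivity), ← ENNReal.ofReal_mul (by positivity)]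
      congr 1
      rw [rpow_two, show -(t⁻¹ + r⁻¹) * z ^ 2 = -(z ^ 2 / t) + -(z ^ 2 / r) by
        field_simp; ring, exp_add,
        show -(b * (t + r)) = -(b * t) + -(b * r) by ring, exp_add]
      ring
    rw [setLIntegral_congr_fun measurableSet_Ioi e3,
      ← ofReal_integral_eq_lintegral_ofReal
      ((integrableOn_rpow_mul_exp_neg_mul_rpow (by linarith) (by norm_num) hA).const_mul _)
      ((ae_restrict_iff' measurableSet_Ioi).2 (.of_forall fun z (hz : 0 < z) => by
        simp only [Pi.zero_apply]; positivity)), integral_const_mul,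
      integral_rpow_mul_exp_neg_mul_rpow (by norm_num) (by linarith) hA]
    congr 1
    rw [show -(1 + 2 * c + 1) / 2 = -c - 1 by ring, show (1 + 2 * c + 1) / 2 = 1 + c by ring,
      show t⁻¹ + r⁻¹ = (t + r) / (t * r) by field_simp; ring,
      div_rpow (by positivity) (by positivity), mul_rpow ht.le hr.le,
      show -(1 + c) = -c - 1 by ring]
    have := rpow_pos_of_pos ht (-c - 1)
    have := rpow_pos_of_pos hr (-c - 1)
    field_simp
  change ∫⁻ z in Ioi 0, ENNReal.ofReal (z ^ (1 + 2 * c)) * (∫⁻ t in Ioi 0, φ z t) ^ 2 = _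
  simp_rw [e1]
  rw [lintegral_lintegral_swap (by fun_prop)]
  have e4 : ∀ t ∈ Ioi (0 : ℝ),
      ∫⁻ z in Ioi 0, ∫⁻ r in Ioi 0, ENNReal.ofReal (z ^ (1 + 2 * c)) * φ z t * φ z r =
      ∫⁻ r in Ioi 0, ENNReal.ofReal (1 / 2 * Real.Gamma (1 + c) *
        ((t + r) ^ (-(1 + c)) * exp (-(b * (t + r))))) := by
    intro t ht
    rw [lintegral_lintegral_swap (by fun_prop)]
    exact setLIntegral_congr_fun measurableSet_Ioi fun r hr => e2 t ht r hr
  rw [setLIntegral_congr_fun measurableSet_Ioi e4,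
    lintegral_Ioi_Ioi_comp_add (f := fun v => ENNReal.ofReal (1 / 2 * Real.Gamma (1 + c) *
        (v ^ (-(1 + c)) * exp (-(b * v))))) (by fun_prop)]
  have hG : 0 < Real.Gamma (1 + c) := Gamma_pos_of_pos (by linarith)
  have e5 : ∀ v ∈ Ioi (0 : ℝ), ENNReal.ofReal v * ENNReal.ofReal (1 / 2 * Real.Gamma (1 + c) *
        (v ^ (-(1 + c)) * exp (-(b * v)))) = ENNReal.ofReal (1 / 2 * Real.Gamma (1 + c)) *
        ENNReal.ofReal (v ^ ((1 - c) - 1) * exp (-(b * v))) := by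
    intro v (hv : 0 < v)
    rw [← ENNReal.ofReal_mul hv.le, ← ENNReal.ofReal_mul (by positivity),
      show 1 - c - 1 = -(1 + c) + 1 by ring, rpow_add_one hv.ne']
    congr 1
    ring
  rw [setLIntegral_congr_fun measurableSet_Ioi e5, lintegral_const_mul _ (by fun_prop),
    lintegral_rpow_mul_exp (by linarith) hb, ← ENNReal.ofReal_mul (by positivity), neg_sub]

theorem fourier_gaussian_ofReal {n : ℕ} {t : ℝ} (ht : 0 < t) (w : EuclideanSpace ℝ (Fin n)) :
    𝓕 (fun v : EuclideanSpace ℝ (Fin n) => ((exp (-(‖v‖ ^ 2 / t)) : ℝ) : ℂ)) w =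
      (((π * t) ^ ((n : ℝ) / 2) * exp (-(π ^ 2 * ‖w‖ ^ 2 * t)) : ℝ) : ℂ) := by
  have h := fourier_gaussian_innerProductSpace (V := EuclideanSpace ℝ (Fin n))
    (b := ((t⁻¹ : ℝ) : ℂ)) (by rw [Complex.ofReal_re]; positivity) w
  rw [Complex.ofReal_mul, Complex.ofReal_cpow (by positivity)]
  convert! h using 2
  · ext v
    push_cast
    congr 1
    ring
  · push_cast
    simp
  · push_cast
    congr 1
    field_simp

theorem integrable_gaussian {n : ℕ} {t : ℝ} (ht : 0 < t) :
    Integrable (fun v : EuclideanSpace ℝ (Fin n) => exp (-(‖v‖ ^ 2 / t))) := by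
  have h := GaussianFourier.integrable_cexp_neg_mul_sq_norm_add (V := EuclideanSpace ℝ (Fin n))
    (b := ((t⁻¹ : ℝ) : ℂ)) (by rw [Complex.ofReal_re]; positivity) 0 0
  refine h.re.congr (.of_forall fun v => ?_)
  simp only [zero_mul, add_zero]
  rw [show -((t⁻¹ : ℝ) : ℂ) * (‖v‖ : ℂ) ^ 2 = ((-(‖v‖ ^ 2 / t) : ℝ) : ℂ) by push_cast; ring,
    ← Complex.ofReal_exp]
  exact Complex.ofReal_re _

theorem integral_gaussian_norm {n : ℕ} {t : ℝ} (ht : 0 < t) :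
    ∫ v : EuclideanSpace ℝ (Fin n), exp (-(‖v‖ ^ 2 / t)) = (π * t) ^ ((n : ℝ) / 2) := by
  have h := GaussianFourier.integral_rexp_neg_mul_sq_norm (V := EuclideanSpace ℝ (Fin n))
    (b := t⁻¹) (by positivity)
  rw [finrank_euclideanSpace_fin] at h
  convert! h using 2
  · ext v
    congr 1
    ring
  · simp

theorem integrable_subord_prod {n : ℕ} {e z : ℝ} (he : (n : ℝ) / 2 < e) (hz : 0 < z) :
    Integrable (fun p : ℝ × EuclideanSpace ℝ (Fin n) =>
      p.1 ^ (-e - 1) * exp (-(z ^ 2 / p.1)) * exp (-(‖p.2‖ ^ 2 / p.1)))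
      ((volume.restrict (Ioi 0)).prod volume) := by
  have hm : Measurable (fun p : ℝ × EuclideanSpace ℝ (Fin n) =>
      p.1 ^ (-e - 1) * exp (-(z ^ 2 / p.1)) * exp (-(‖p.2‖ ^ 2 / p.1))) := by fun_prop
  rw [integrable_prod_iff hm.aestronglyMeasurable]
  refine ⟨(ae_restrict_iff' measurableSet_Ioi).2 (.of_forall fun t (ht : 0 < t) =>
    (integrable_gaussian ht).const_mul (t ^ (-e - 1) * exp (-(z ^ 2 / t)))), ?_⟩
  have h : IntegrableOn (fun t : ℝ => π ^ ((n : ℝ) / 2) *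
      (t ^ (-(e - (n : ℝ) / 2) - 1) * exp (-(z ^ 2 / t)))) (Ioi 0) :=
    (integrableOn_rpow_mul_exp_neg_div (by linarith) (by positivity)).const_mul _
  refine h.congr_fun (fun t (ht : 0 < t) => ?_) measurableSet_Ioi
  have h2 : ∀ v : EuclideanSpace ℝ (Fin n),
      ‖t ^ (-e - 1) * exp (-(z ^ 2 / t)) * exp (-(‖v‖ ^ 2 / t))‖ =
      t ^ (-e - 1) * exp (-(z ^ 2 / t)) * exp (-(‖v‖ ^ 2 / t)) :=
    fun v => norm_of_nonneg (by positivity)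
  simp only [h2, integral_const_mul, integral_gaussian_norm ht]
  rw [mul_rpow pi_pos.le ht.le, show -(e - (n : ℝ) / 2) - 1 = (-e - 1) + n / 2 by ring,
    rpow_add ht]
  ring

theorem rpow_neg_eq_integral_subord {e z r : ℝ} (he : 0 < e) (hz : 0 < z) :
    (r ^ 2 + z ^ 2) ^ (-e) = (Real.Gamma e)⁻¹ *
      ∫ t in Ioi (0 : ℝ), t ^ (-e - 1) * exp (-(z ^ 2 / t)) * exp (-(r ^ 2 / t)) := by
  have h := integral_rpow_mul_exp_neg_div he (A := r ^ 2 + z ^ 2) (by positivity)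
  have hG := Gamma_pos_of_pos he
  rw [eq_inv_mul_iff_mul_eq₀ hG.ne', ← h]
  refine setIntegral_congr_fun measurableSet_Ioi (fun t ht => ?_)
  rw [mul_assoc, ← exp_add]
  ring_nf

theorem integrable_rpow_neg_norm {n : ℕ} {e z : ℝ} (he : (n : ℝ) / 2 < e) (hz : 0 < z) :
    Integrable (fun x : EuclideanSpace ℝ (Fin n) => (‖x‖ ^ 2 + z ^ 2) ^ (-e)) := by
  have he0 : 0 < e := lt_of_le_of_lt (by positivity) he
  simp_rw [rpow_neg_eq_integral_subord he0 hz]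
  exact (integrable_subord_prod he hz).integral_prod_right.const_mul _

theorem fourier_rpow_neg_norm {n : ℕ} {e z : ℝ} (he : (n : ℝ) / 2 < e) (hz : 0 < z)
    (ξ : EuclideanSpace ℝ (Fin n)) :
    𝓕 (fun x : EuclideanSpace ℝ (Fin n) => (((‖x‖ ^ 2 + z ^ 2) ^ (-e) : ℝ) : ℂ)) ξ =
      ((π ^ ((n : ℝ) / 2) / Real.Gamma e *
        subordInt (e - (n : ℝ) / 2) z (π ^ 2 * ‖ξ‖ ^ 2) : ℝ) : ℂ) := by
  have he0 : 0 < e := lt_of_le_of_lt (by positivity) he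
  have hint : Integrable (fun p : EuclideanSpace ℝ (Fin n) × ℝ =>
      𝐞 (-inner ℝ p.1 ξ) •
      ((p.2 ^ (-e - 1) * exp (-(z ^ 2 / p.2)) * exp (-(‖p.1‖ ^ 2 / p.2)) : ℝ) : ℂ))
      (volume.prod (volume.restrict (Ioi 0))) := by
    have h := (integrable_subord_prod he hz).swap.ofReal (𝕜 := ℂ)
    refine h.mono ?_ (.of_forall fun p => ?_)
    · have : Continuous fun p : EuclideanSpace ℝ (Fin n) × ℝ => 𝐞 (-inner ℝ p.1 ξ) :=
        continuous_fourierChar.comp (by fun_prop)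
      exact this.aestronglyMeasurable.smul h.1
    · rw [Circle.norm_smul]
      rfl
  calc _ = ∫ x : EuclideanSpace ℝ (Fin n), ((Real.Gamma e)⁻¹ : ℂ) * ∫ t in Ioi (0 : ℝ),
        𝐞 (-inner ℝ x ξ) •
        ((t ^ (-e - 1) * exp (-(z ^ 2 / t)) * exp (-(‖x‖ ^ 2 / t)) : ℝ) : ℂ) := by
        rw [Real.fourier_eq]
        congr 1
        ext x
        rw [rpow_neg_eq_integral_subord he0 hz, Complex.ofReal_mul, ← integral_complex_ofReal]
        simp only [Circle.smul_def, smul_eq_mul]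
        rw [integral_const_mul, Complex.ofReal_inv]
        ring
    _ = ((Real.Gamma e)⁻¹ : ℂ) * ∫ t in Ioi (0 : ℝ), ∫ x : EuclideanSpace ℝ (Fin n),
        𝐞 (-inner ℝ x ξ) •
        ((t ^ (-e - 1) * exp (-(z ^ 2 / t)) * exp (-(‖x‖ ^ 2 / t)) : ℝ) : ℂ) := by
        rw [integral_const_mul, integral_integral_swap hint]
    _ = ((Real.Gamma e)⁻¹ : ℂ) * ∫ t in Ioi (0 : ℝ), ((π ^ ((n : ℝ) / 2) *
        (t ^ (-(e - (n : ℝ) / 2) - 1) * exp (-(z ^ 2 / t)) *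
          exp (-(π ^ 2 * ‖ξ‖ ^ 2 * t))) : ℝ) : ℂ) := by
        congr 1
        refine setIntegral_congr_fun measurableSet_Ioi (fun t (ht : 0 < t) => ?_)
        have h := fourier_gaussian_ofReal ht ξ
        rw [Real.fourier_eq] at h
        calc _ = ∫ x : EuclideanSpace ℝ (Fin n), ((t ^ (-e - 1) * exp (-(z ^ 2 / t)) : ℝ) : ℂ) *
              (𝐞 (-inner ℝ x ξ) • ((exp (-(‖x‖ ^ 2 / t)) : ℝ) : ℂ)) := by
              congr 1
              ext x
              push_cast
              simp only [Circle.smul_def, smul_eq_mul]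
              ring
          _ = _ := by
              rw [integral_const_mul, h, ← Complex.ofReal_mul]
              congr 1
              rw [mul_rpow pi_pos.le ht.le,
                show -(e - (n : ℝ) / 2) - 1 = (-e - 1) + n / 2 by ring, rpow_add ht]
              ring
    _ = _ := by
        rw [integral_complex_ofReal, integral_const_mul, subordInt, ← Complex.ofReal_inv,
          ← Complex.ofReal_mul]
        congr 1
        ring

theorem lintegral_norm_sq_fourier {n : ℕ} {w : EuclideanSpace ℝ (Fin n) → ℂ}
    (hc : Continuous w) (hi : Integrable w) (hF : Integrable (𝓕 w)) :
    ∫⁻ x, ENNReal.ofReal (‖w x‖ ^ 2) = ∫⁻ ξ, ENNReal.ofReal (‖𝓕 w ξ‖ ^ 2) := by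
  have hinv := hc.fourierInv_fourier_eq hi hF
  have hb1 : ∀ ξ, ‖𝓕 w ξ‖ ≤ ∫ x, ‖w x‖ := fun ξ =>
    VectorFourier.norm_fourierIntegral_le_integral_norm _ _ _ _ _
  have hb2 : ∀ x, ‖w x‖ ≤ ∫ ξ, ‖𝓕 w ξ‖ := fun x => by
    rw [← congrFun hinv x]
    exact VectorFourier.norm_fourierIntegral_le_integral_norm _ _ _ _ _
  have hI1 : Integrable fun x => ‖w x‖ ^ 2 := by
    refine (hi.norm.const_mul (∫ ξ, ‖𝓕 w ξ‖)).mono' (hc.norm.pow 2).aestronglyMeasurable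
      (.of_forall fun x => ?_)
    rw [norm_of_nonneg (by positivity), sq]
    exact mul_le_mul_of_nonneg_right (hb2 x) (norm_nonneg _)
  have hI2 : Integrable fun ξ => ‖𝓕 w ξ‖ ^ 2 := by
    refine (hF.norm.const_mul (∫ x, ‖w x‖)).mono' (hF.1.norm.pow 2)
      (.of_forall fun x => ?_)
    rw [norm_of_nonneg (by positivity), sq]
    exact mul_le_mul_of_nonneg_right (hb1 x) (norm_nonneg _)
  rw [← ofReal_integral_eq_lintegral_ofReal hI1 (.of_forall fun _ => by positivity),
    ← ofReal_integral_eq_lintegral_ofReal hI2 (.of_forall fun _ => by positivity)]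
  congr 1
  have h : ∫ ξ, inner ℂ (𝓕 w ξ) (𝓕 w ξ) = ∫ x, inner ℂ (w x) (𝓕⁻ (𝓕 w) x) := by
    have h := VectorFourier.integral_sesq_fourierIntegral_eq_neg_flip (innerSL ℂ)
      (L := innerₗ (EuclideanSpace ℝ (Fin n))) continuous_fourierChar continuous_inner hi hF
    rw [flip_innerₗ] at h
    exact h
  rw [hinv] at h
  simp only [inner_self_eq_norm_sq_to_K] at h
  apply Complex.ofReal_injective
  rw [← integral_complex_ofReal, ← integral_complex_ofReal]
  simpa using h.symm

/-- A real Schwartz function viewed as a complex one. -/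
noncomputable def SchwartzMap.complexify {n : ℕ} (v : SchwartzMap (EuclideanSpace ℝ (Fin n)) ℝ) :
    SchwartzMap (EuclideanSpace ℝ (Fin n)) ℂ :=
  SchwartzMap.postcompCLM (𝕜 := ℝ) Complex.ofRealCLM v

theorem SchwartzMap.complexify_apply {n : ℕ} (v : SchwartzMap (EuclideanSpace ℝ (Fin n)) ℝ)
    (x : EuclideanSpace ℝ (Fin n)) : v.complexify x = (v x : ℂ) := rfl

theorem lintegral_conv_sq {n : ℕ} {k : EuclideanSpace ℝ (Fin n) → ℝ} (hk : Integrable k)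
    (v : SchwartzMap (EuclideanSpace ℝ (Fin n)) ℝ) :
    ∫⁻ x, ENNReal.ofReal ((∫ y, k (x - y) * v y) ^ 2) =
      ∫⁻ ξ, ENNReal.ofReal (‖𝓕 (fun x => (k x : ℂ)) ξ‖ ^ 2 * ‖𝓕 v.complexify ξ‖ ^ 2) := by
  set kC : EuclideanSpace ℝ (Fin n) → ℂ := fun x => (k x : ℂ) with hkC
  have hkCi : Integrable kC := hk.ofReal
  set vC := v.complexify with hvC
  set w := MeasureTheory.convolution kC vC (ContinuousLinearMap.mul ℂ ℂ) volume with hw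
  have hwx : ∀ x, w x = ((∫ y, k (x - y) * v y : ℝ) : ℂ) := by
    intro x
    rw [hw, convolution_def, ← integral_complex_ofReal, ← integral_sub_left_eq_self _ volume x]
    refine integral_congr_ae (.of_forall fun y => ?_)
    simp [hkC, hvC, SchwartzMap.complexify_apply]
  have hFw : 𝓕 w = fun ξ => 𝓕 kC ξ * 𝓕 vC ξ := by
    ext ξ
    exact Real.fourier_mul_convolution_eq hkCi vC.integrable ξ
  have hwc : Continuous w := by
    refine BddAbove.continuous_convolution_right_of_integrable _ ?_ hkCi vC.continuous
    exact ⟨_, by rintro _ ⟨x, rfl⟩; exact vC.toBoundedContinuousFunction.norm_coe_le_norm x⟩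
  have hwi : Integrable w := hkCi.integrable_convolution _ vC.integrable
  have hFi : Integrable (𝓕 w) := by
    rw [hFw]
    refine (𝓕 vC).integrable.bdd_mul (c := ∫ x, ‖kC x‖) ?_ (.of_forall fun ξ =>
      VectorFourier.norm_fourierIntegral_le_integral_norm _ _ _ _ _)
    exact (VectorFourier.fourierIntegral_continuous continuous_fourierChar continuous_inner
      hkCi).aestronglyMeasurable
  have h := lintegral_norm_sq_fourier hwc hwi hFi
  simp only [hFw, hwx, norm_mul, mul_pow, Complex.norm_real, norm_eq_abs, sq_abs] at h
  exact h

theorem lintegral_sub_translate_sq {n : ℕ} (v : SchwartzMap (EuclideanSpace ℝ (Fin n)) ℝ)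
    (h : EuclideanSpace ℝ (Fin n)) :
    ∫⁻ x, ENNReal.ofReal ((v x - v (x + h)) ^ 2) =
      ∫⁻ ξ, ENNReal.ofReal ((2 - 2 * Real.cos (2 * π * inner ℝ h ξ)) *
        ‖𝓕 v.complexify ξ‖ ^ 2) := by
  set g := v.complexify - SchwartzMap.compSubConstCLM ℂ (-h) v.complexify with hg
  have e1 : ∀ x, ‖g x‖ ^ 2 = (v x - v (x + h)) ^ 2 := by
    intro x
    simp only [hg, sub_apply, SchwartzMap.compSubConstCLM_apply,
      SchwartzMap.complexify_apply, sub_neg_eq_add]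
    rw [← Complex.ofReal_sub, Complex.norm_real, norm_eq_abs, sq_abs]
  have e2 : ∀ ξ, ‖𝓕 g ξ‖ ^ 2 = (2 - 2 * Real.cos (2 * π * inner ℝ h ξ)) *
        ‖𝓕 v.complexify ξ‖ ^ 2 := by
    intro ξ
    have h1 : 𝓕 (SchwartzMap.compSubConstCLM ℂ (-h) v.complexify) ξ =
        𝐞 (inner ℝ h ξ) • 𝓕 v.complexify ξ := by
      have := congrFun (VectorFourier.fourierIntegral_comp_add_right 𝐞 volume
        (innerₗ (EuclideanSpace ℝ (Fin n))) v.complexify h) ξ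
      rw [SchwartzMap.fourier_coe, SchwartzMap.fourier_coe]
      convert! this using 3
      ext x
      simp
    have h2 : 𝓕 g ξ = (1 - (𝐞 (inner ℝ h ξ) : ℂ)) * 𝓕 v.complexify ξ := by
      rw [hg, sub_eq_add_neg, FourierTransform.fourier_add, FourierTransform.fourier_neg,
        ← sub_eq_add_neg, sub_apply, h1, Circle.smul_def, smul_eq_mul]
      ring
    rw [h2, norm_mul, mul_pow, fourierChar_apply]
    congr 1
    rw [← Complex.normSq_eq_norm_sq, Complex.normSq_apply]
    simp [Complex.exp_re, Complex.exp_im]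
    nlinarith [Real.sin_sq_add_cos_sq (2 * π * inner ℝ h ξ)]
  have key := lintegral_norm_sq_fourier g.continuous g.integrable (w := g) (by
    rw [← SchwartzMap.fourier_coe]; exact (𝓕 g).integrable)
  simp only [← SchwartzMap.fourier_coe, e1, e2] at key
  exact key

theorem lintegral_gaussian_mul_one_sub_cos {n : ℕ} {t : ℝ} (ht : 0 < t)
    (ξ : EuclideanSpace ℝ (Fin n)) :
    ∫⁻ h : EuclideanSpace ℝ (Fin n),
        ENNReal.ofReal (exp (-(‖h‖ ^ 2 / t)) * (2 - 2 * Real.cos (2 * π * inner ℝ h ξ))) =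
      ENNReal.ofReal (2 * (π * t) ^ ((n : ℝ) / 2) * (1 - exp (-(π ^ 2 * ‖ξ‖ ^ 2 * t)))) := by
  have hg := integrable_gaussian (n := n) ht
  have hgc : Integrable fun h : EuclideanSpace ℝ (Fin n) =>
      exp (-(‖h‖ ^ 2 / t)) * Real.cos (2 * π * inner ℝ h ξ) := by
    refine hg.mul_bdd (c := 1) (by fun_prop) (.of_forall fun h => ?_)
    exact abs_cos_le_one _
  have hcos : ∫ h : EuclideanSpace ℝ (Fin n),
      exp (-(‖h‖ ^ 2 / t)) * Real.cos (2 * π * inner ℝ h ξ) =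
      (π * t) ^ ((n : ℝ) / 2) * exp (-(π ^ 2 * ‖ξ‖ ^ 2 * t)) := by
    have h := congrArg Complex.re (fourier_gaussian_ofReal ht ξ)
    rw [Real.fourier_eq, Complex.ofReal_re] at h
    rw [← h, ← Complex.reCLM_apply, ← ContinuousLinearMap.integral_comp_comm]
    · congr 1
      ext x
      simp only [Circle.smul_def, smul_eq_mul, fourierChar_apply, Complex.reCLM_apply]
      rw [mul_comm, Complex.re_mul_ofReal, Complex.exp_ofReal_mul_I_re]
      congr 1
      rw [mul_neg, Real.cos_neg]
    · exact (Real.fourierIntegral_convergent_iff ξ).2 hg.ofReal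
  rw [← ofReal_integral_eq_lintegral_ofReal]
  · congr 1
    calc _ = ∫ h : EuclideanSpace ℝ (Fin n), (2 * exp (-(‖h‖ ^ 2 / t)) -
          2 * (exp (-(‖h‖ ^ 2 / t)) * Real.cos (2 * π * inner ℝ h ξ))) := by
          congr 1
          ext h
          ring
      _ = _ := by
          rw [integral_sub (hg.const_mul 2) (hgc.const_mul 2), integral_const_mul,
            integral_const_mul, hcos, integral_gaussian_norm ht]
          ring
  · refine ((hg.const_mul 2).sub (hgc.const_mul 2)).congr (.of_forall fun h => ?_)
    simp only [Pi.sub_apply]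
    ring
  · refine .of_forall fun h => mul_nonneg (exp_pos _).le ?_
    linarith [cos_le_one (2 * π * inner ℝ h ξ)]

theorem lintegral_one_sub_cos_div_norm {n : ℕ} (hn : 1 ≤ n) {a : ℝ} (ha : a ∈ Ioo (0 : ℝ) 1)
    {ξ : EuclideanSpace ℝ (Fin n)} (hξ : ξ ≠ 0) :
    ∫⁻ h : EuclideanSpace ℝ (Fin n),
        ENNReal.ofReal (‖h‖ ^ (-((n : ℝ) + 2 * a)) * (2 - 2 * Real.cos (2 * π * inner ℝ h ξ))) =
      ENNReal.ofReal (2 * π ^ ((n : ℝ) / 2) / Real.Gamma (n / 2 + a) *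
        ((π ^ 2 * ‖ξ‖ ^ 2) ^ a * Real.Gamma (1 - a) / a)) := by
  have : Nonempty (Fin n) := ⟨⟨0, hn⟩⟩
  have : Nontrivial (EuclideanSpace ℝ (Fin n)) := inferInstance
  have ha0 := ha.1
  set e : ℝ := n / 2 + a with he
  have he0 : 0 < e := by positivity
  have hG := Gamma_pos_of_pos he0
  have hb : 0 < π ^ 2 * ‖ξ‖ ^ 2 := by positivity
  have hnn : ∀ h : EuclideanSpace ℝ (Fin n), 0 ≤ 2 - 2 * Real.cos (2 * π * inner ℝ h ξ) :=
    fun h => by linarith [cos_le_one (2 * π * inner ℝ h ξ)]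
  calc _ = ∫⁻ h : EuclideanSpace ℝ (Fin n), ∫⁻ t in Ioi (0 : ℝ),
        ENNReal.ofReal ((Real.Gamma e)⁻¹ * t ^ (-e - 1)) *
        ENNReal.ofReal (exp (-(‖h‖ ^ 2 / t)) * (2 - 2 * Real.cos (2 * π * inner ℝ h ξ))) := by
        refine lintegral_congr_ae ?_
        filter_upwards [Measure.ae_ne volume (0 : EuclideanSpace ℝ (Fin n))] with h hh
        have hA : 0 < ‖h‖ ^ 2 := by positivity
        have key : ‖h‖ ^ (-((n : ℝ) + 2 * a)) = (Real.Gamma e)⁻¹ *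
            ∫ t in Ioi (0 : ℝ), t ^ (-e - 1) * exp (-(‖h‖ ^ 2 / t)) := by
          rw [integral_rpow_mul_exp_neg_div he0 hA, inv_mul_cancel_left₀ hG.ne',
            ← rpow_natCast, ← rpow_mul (norm_nonneg h)]
          congr 1
          rw [he]
          push_cast
          ring
        rw [key, ENNReal.ofReal_mul (mul_nonneg (by positivity)
          (setIntegral_nonneg measurableSet_Ioi fun t (ht : 0 < t) => by positivity)),
          ENNReal.ofReal_mul (by positivity), ofReal_integral_eq_lintegral_ofReal
            (integrableOn_rpow_mul_exp_neg_div he0 hA)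
            ((ae_restrict_iff' measurableSet_Ioi).2 (.of_forall fun t (ht : 0 < t) => by
              positivity)),
          ← lintegral_const_mul _ (by fun_prop), ← lintegral_mul_const _ (by fun_prop)]
        refine setLIntegral_congr_fun measurableSet_Ioi (fun t (ht : 0 < t) => ?_)
        rw [← ENNReal.ofReal_mul (by positivity), ← ENNReal.ofReal_mul (by positivity),
          ← ENNReal.ofReal_mul (by positivity)]
        congr 1
        ring
    _ = ∫⁻ t in Ioi (0 : ℝ), ∫⁻ h : EuclideanSpace ℝ (Fin n),
        ENNReal.ofReal ((Real.Gamma e)⁻¹ * t ^ (-e - 1)) *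
        ENNReal.ofReal (exp (-(‖h‖ ^ 2 / t)) * (2 - 2 * Real.cos (2 * π * inner ℝ h ξ))) :=
        lintegral_lintegral_swap (by fun_prop)
    _ = ∫⁻ t in Ioi (0 : ℝ), ENNReal.ofReal (2 * π ^ ((n : ℝ) / 2) / Real.Gamma e) *
        ENNReal.ofReal (t ^ (-a - 1) * (1 - exp (-(π ^ 2 * ‖ξ‖ ^ 2 * t)))) := by
        refine setLIntegral_congr_fun measurableSet_Ioi (fun t (ht : 0 < t) => ?_)
        rw [lintegral_const_mul _ (by fun_prop), lintegral_gaussian_mul_one_sub_cos ht,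
          ← ENNReal.ofReal_mul (by positivity), ← ENNReal.ofReal_mul (by positivity)]
        congr 1
        rw [mul_rpow pi_pos.le ht.le, show -a - 1 = (-e - 1) + n / 2 by rw [he]; ring,
          rpow_add ht]
        ring
    _ = _ := by
        rw [lintegral_const_mul _ (by fun_prop), lintegral_rpow_mul_one_sub_exp ha hb,
          ← ENNReal.ofReal_mul (by positivity)]

theorem lintegral_gagliardo {n : ℕ} (hn : 1 ≤ n) {s : ℝ} (hs : s ∈ Ioo (0 : ℝ) 2)
    (u : SchwartzMap (EuclideanSpace ℝ (Fin n)) ℝ) :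
    ∫⁻ q : EuclideanSpace ℝ (Fin n) × EuclideanSpace ℝ (Fin n), ENNReal.ofReal
        (alphaConst n s * (u q.1 - u q.2) ^ 2 / ‖q.1 - q.2‖ ^ ((n : ℝ) + s)) =
      ∫⁻ ξ, ENNReal.ofReal (2 * 2 ^ s * (π ^ 2 * ‖ξ‖ ^ 2) ^ (s / 2) *
        ‖𝓕 u.complexify ξ‖ ^ 2) := by
  have : Nonempty (Fin n) := ⟨⟨0, hn⟩⟩
  have : Nontrivial (EuclideanSpace ℝ (Fin n)) := inferInstance
  obtain ⟨hs0, hs2⟩ := hs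
  have hG : 0 < Real.Gamma (((n : ℝ) + s) / 2) := Gamma_pos_of_pos (by positivity)
  have hG' : 0 < Real.Gamma (1 - s / 2) := Gamma_pos_of_pos (by linarith)
  have hα : 0 ≤ alphaConst n s := by
    unfold alphaConst
    positivity
  have huc : Continuous u := u.continuous
  have hFc : Continuous fun ξ => 𝓕 u.complexify ξ := (𝓕 u.complexify).continuous
  have hnn : ∀ h ξ : EuclideanSpace ℝ (Fin n), 0 ≤ 2 - 2 * Real.cos (2 * π * inner ℝ h ξ) :=
    fun h ξ => by linarith [cos_le_one (2 * π * inner ℝ h ξ)]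
  calc _ = ∫⁻ x, ∫⁻ y, ENNReal.ofReal
        (alphaConst n s * (u x - u y) ^ 2 / ‖x - y‖ ^ ((n : ℝ) + s)) := by
        rw [Measure.volume_eq_prod, lintegral_prod]
        fun_prop
    _ = ∫⁻ x, ∫⁻ h, ENNReal.ofReal (alphaConst n s * ‖h‖ ^ (-((n : ℝ) + s))) *
        ENNReal.ofReal ((u x - u (x + h)) ^ 2) := by
        refine lintegral_congr fun x => ?_
        rw [← lintegral_add_left_eq_self _ x]
        refine lintegral_congr fun h => ?_
        rw [← ENNReal.ofReal_mul (by positivity), rpow_neg (norm_nonneg _)]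
        congr 1
        rw [sub_add_cancel_left, norm_neg]
        ring
    _ = ∫⁻ h, ∫⁻ x, ENNReal.ofReal (alphaConst n s * ‖h‖ ^ (-((n : ℝ) + s))) *
        ENNReal.ofReal ((u x - u (x + h)) ^ 2) := lintegral_lintegral_swap (by fun_prop)
    _ = ∫⁻ h, ∫⁻ ξ, ENNReal.ofReal (alphaConst n s * ‖h‖ ^ (-((n : ℝ) + s))) *
        ENNReal.ofReal ((2 - 2 * Real.cos (2 * π * inner ℝ h ξ)) *
        ‖𝓕 u.complexify ξ‖ ^ 2) := by
        refine lintegral_congr fun h => ?_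
        rw [lintegral_const_mul _ (by fun_prop), lintegral_const_mul _ (by fun_prop),
          lintegral_sub_translate_sq]
    _ = ∫⁻ ξ, ∫⁻ h, ENNReal.ofReal (alphaConst n s * ‖h‖ ^ (-((n : ℝ) + s))) *
        ENNReal.ofReal ((2 - 2 * Real.cos (2 * π * inner ℝ h ξ)) *
        ‖𝓕 u.complexify ξ‖ ^ 2) := lintegral_lintegral_swap (by fun_prop)
    _ = _ := by
        refine lintegral_congr_ae ?_
        filter_upwards [Measure.ae_ne volume (0 : EuclideanSpace ℝ (Fin n))] with ξ hξ
        have h := lintegral_one_sub_cos_div_norm hn (a := s / 2)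
          ⟨by linarith, by linarith⟩ hξ
        calc _ = ∫⁻ h : EuclideanSpace ℝ (Fin n),
              ENNReal.ofReal (alphaConst n s * ‖𝓕 u.complexify ξ‖ ^ 2) *
              ENNReal.ofReal (‖h‖ ^ (-((n : ℝ) + 2 * (s / 2))) *
                (2 - 2 * Real.cos (2 * π * inner ℝ h ξ))) := by
              refine lintegral_congr fun h => ?_
              rw [← ENNReal.ofReal_mul (by positivity), ← ENNReal.ofReal_mul (by positivity),
                mul_div_cancel₀ s two_ne_zero]
              congr 1
              ring
          _ = _ := by
              rw [lintegral_const_mul _ (by fun_prop), h, ← ENNReal.ofReal_mul (by positivity)]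
              congr 1
              have hpi : 0 < π ^ ((n : ℝ) / 2) := by positivity
              rw [alphaConst, rpow_sub_one two_ne_zero,
                show (n : ℝ) / 2 + s / 2 = (n + s) / 2 by ring]
              field_simp

theorem measurable_subordInt (c : ℝ) : Measurable fun p : ℝ × ℝ => subordInt c p.1 p.2 := by
  have h : StronglyMeasurable fun q : (ℝ × ℝ) × ℝ =>
      q.2 ^ (-c - 1) * exp (-(q.1.1 ^ 2 / q.2)) * exp (-(q.1.2 * q.2)) :=
    Measurable.stronglyMeasurable (by fun_prop)
  exact h.integral_prod_right.measurable

theorem subordInt_nonneg (c z b : ℝ) : 0 ≤ subordInt c z b :=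
  setIntegral_nonneg measurableSet_Ioi fun t (ht : 0 < t) => by positivity

theorem lintegral_rpow_mul_subordInt_sq {b c : ℝ} (hc : c ∈ Ioo (-1 : ℝ) 1) (hc0 : c ≠ 0)
    (hb : 0 < b) :
    ∫⁻ z in Ioi 0, ENNReal.ofReal (z ^ (1 + 2 * c) * subordInt c z b ^ 2) =
      ENNReal.ofReal (1 / 2 * Real.Gamma (1 + c) * (Real.Gamma (1 - c) * b ^ (c - 1))) := by
  rw [← lintegral_subord_sq hc hb]
  refine setLIntegral_congr_fun measurableSet_Ioi fun z (hz : 0 < z) => ?_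
  have hi : IntegrableOn
      (fun t : ℝ => t ^ (-c - 1) * exp (-(z ^ 2 / t)) * exp (-(b * t))) (Ioi 0) := by
    rcases lt_or_gt_of_ne hc0 with h | h
    · exact integrableOn_subord_of_neg h hb
    · exact integrableOn_subord_of_pos h hz hb.le
  rw [ENNReal.ofReal_mul (by positivity), ENNReal.ofReal_pow (subordInt_nonneg _ _ _), subordInt,
    ofReal_integral_eq_lintegral_ofReal hi ((ae_restrict_iff' measurableSet_Ioi).2
      (.of_forall fun t (ht : 0 < t) => by positivity))]

/-- The modulus of the Fourier multiplier of the Poisson kernel at height `z`, with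
`b = π² ‖ξ‖²`. -/
noncomputable def poissonMultiplier (s z b : ℝ) : ℝ :=
  z ^ s / Real.Gamma (s / 2) * subordInt (s / 2) z b

/-- The modulus of the Fourier multiplier of the vertical derivative of the Poisson kernel. -/
noncomputable def poissonDerivMultiplier (s z b : ℝ) : ℝ :=
  2 / Real.Gamma (s / 2) * z ^ (s - 1) * b * subordInt (s / 2 - 1) z b

theorem lintegral_multiplier_energy {s b : ℝ} (hs : s ∈ Ioo (0 : ℝ) 2) (hb : 0 < b) :
    ∫⁻ z in Ioi 0, ENNReal.ofReal (z ^ (1 - s) *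
        (4 * b * poissonMultiplier s z b ^ 2 + poissonDerivMultiplier s z b ^ 2)) =
      ENNReal.ofReal (2 * b ^ (s / 2) * Real.Gamma (1 - s / 2) / Real.Gamma (s / 2)) := by
  obtain ⟨hs0, hs2⟩ := hs
  have hG : 0 < Real.Gamma (s / 2) := Gamma_pos_of_pos (by positivity)
  have hG' : 0 < Real.Gamma (1 - s / 2) := Gamma_pos_of_pos (by linarith)
  have hG1 : Real.Gamma (1 + s / 2) = s / 2 * Real.Gamma (s / 2) := by
    rw [add_comm, Gamma_add_one (by positivity)]
  have hG2 : Real.Gamma (1 - (s / 2 - 1)) = (1 - s / 2) * Real.Gamma (1 - s / 2) := by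
    rw [← Gamma_add_one (by linarith)]
    ring_nf
  have hm : ∀ c : ℝ, Measurable fun z => subordInt c z b := fun c =>
    (measurable_subordInt c).comp (measurable_id.prodMk measurable_const)
  calc _ = ∫⁻ z in Ioi 0, (ENNReal.ofReal (4 * b / Real.Gamma (s / 2) ^ 2) *
          ENNReal.ofReal (z ^ (1 + 2 * (s / 2)) * subordInt (s / 2) z b ^ 2) +
        ENNReal.ofReal (4 * b ^ 2 / Real.Gamma (s / 2) ^ 2) *
          ENNReal.ofReal (z ^ (1 + 2 * (s / 2 - 1)) * subordInt (s / 2 - 1) z b ^ 2)) := by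
        refine setLIntegral_congr_fun measurableSet_Ioi fun z (hz : 0 < z) => ?_
        simp only [poissonMultiplier, poissonDerivMultiplier]
        rw [← ENNReal.ofReal_mul (by positivity), ← ENNReal.ofReal_mul (by positivity),
          ← ENNReal.ofReal_add (by positivity) (by positivity)]
        congr 1
        have e1 : z ^ (1 + 2 * (s / 2)) = z ^ (1 - s) * (z ^ s) ^ 2 := by
          rw [← rpow_mul_natCast hz.le, ← rpow_add hz]
          congr 1
          push_cast
          ring
        have e2 : z ^ (1 + 2 * (s / 2 - 1)) = z ^ (1 - s) * (z ^ (s - 1)) ^ 2 := by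
          rw [← rpow_mul_natCast hz.le, ← rpow_add hz]
          congr 1
          push_cast
          ring
        rw [e1, e2]
        ring
    _ = _ := by
        have hm1 := hm (s / 2)
        have hm2 := hm (s / 2 - 1)
        rw [lintegral_add_left (by fun_prop), lintegral_const_mul _ (by fun_prop),
          lintegral_const_mul _ (by fun_prop),
          lintegral_rpow_mul_subordInt_sq ⟨by linarith, by linarith⟩ (by linarith) hb,
          lintegral_rpow_mul_subordInt_sq ⟨by linarith, by linarith⟩ (by linarith) hb,
          hG1, hG2, ← ENNReal.ofReal_mul (by positivity), ← ENNReal.ofReal_mul (by positivity),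
          ← ENNReal.ofReal_add]
        · congr 1
          rw [show 1 + (s / 2 - 1) = s / 2 by ring, rpow_sub_one hb.ne', rpow_sub_one hb.ne',
            rpow_sub_one hb.ne']
          field_simp
          ring
        · positivity
        · rw [show 1 + (s / 2 - 1) = s / 2 by ring]
          have : 0 ≤ 1 - s / 2 := by linarith
          positivity

/-- The Poisson kernel at height `z`. -/
noncomputable def poissonKer (n : ℕ) (s z : ℝ) (x : EuclideanSpace ℝ (Fin n)) : ℝ :=
  sigmaConst n s * z ^ s * (‖x‖ ^ 2 + z ^ 2) ^ (-(((n : ℝ) + s) / 2))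

/-- The derivative of the Poisson kernel with respect to the height. -/
noncomputable def poissonKerDeriv (n : ℕ) (s z : ℝ) (x : EuclideanSpace ℝ (Fin n)) : ℝ :=
  sigmaConst n s * (s * z ^ (s - 1)) * (‖x‖ ^ 2 + z ^ 2) ^ (-(((n : ℝ) + s) / 2)) -
    sigmaConst n s * (((n : ℝ) + s) * z ^ (s + 1)) *
      (‖x‖ ^ 2 + z ^ 2) ^ (-(((n : ℝ) + s) / 2 + 1))

section Kernel

variable {n : ℕ} {s z : ℝ}

theorem integrable_poissonKer (hs : 0 < s) (hz : 0 < z) : Integrable (poissonKer n s z) :=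
  (integrable_rpow_neg_norm (by linarith) hz).const_mul _

theorem integrable_poissonKerDeriv (hs : 0 < s) (hz : 0 < z) :
    Integrable (poissonKerDeriv n s z) :=
  ((integrable_rpow_neg_norm (by linarith) hz).const_mul _).sub
    ((integrable_rpow_neg_norm (by linarith) hz).const_mul _)

theorem fourier_ofReal_const_mul {k : EuclideanSpace ℝ (Fin n) → ℝ} (c : ℝ)
    (ξ : EuclideanSpace ℝ (Fin n)) :
    𝓕 (fun x => ((c * k x : ℝ) : ℂ)) ξ = c * 𝓕 (fun x => (k x : ℂ)) ξ := by
  rw [Real.fourier_eq, Real.fourier_eq, ← integral_const_mul]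
  congr 1
  ext x
  simp only [Circle.smul_def, smul_eq_mul, Complex.ofReal_mul]
  ring

theorem fourier_ofReal_sub {k l : EuclideanSpace ℝ (Fin n) → ℝ} (hk : Integrable k)
    (hl : Integrable l) (ξ : EuclideanSpace ℝ (Fin n)) :
    𝓕 (fun x => ((k x - l x : ℝ) : ℂ)) ξ =
      𝓕 (fun x => (k x : ℂ)) ξ - 𝓕 (fun x => (l x : ℂ)) ξ := by
  rw [Real.fourier_eq, Real.fourier_eq, Real.fourier_eq, ← integral_sub]
  · simp only [Complex.ofReal_sub, smul_sub]
  · exact (Real.fourierIntegral_convergent_iff ξ).2 hk.ofReal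
  · exact (Real.fourierIntegral_convergent_iff ξ).2 hl.ofReal

theorem norm_fourier_poissonKer_sq (hs : 0 < s) (hz : 0 < z) (ξ : EuclideanSpace ℝ (Fin n)) :
    ‖𝓕 (fun x => (poissonKer n s z x : ℂ)) ξ‖ ^ 2 =
      poissonMultiplier s z (π ^ 2 * ‖ξ‖ ^ 2) ^ 2 := by
  have hG : 0 < Real.Gamma (((n : ℝ) + s) / 2) := Gamma_pos_of_pos (by positivity)
  simp only [poissonKer]
  rw [fourier_ofReal_const_mul, fourier_rpow_neg_norm (by linarith) hz, ← Complex.ofReal_mul,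
    Complex.norm_real, norm_eq_abs, sq_abs, poissonMultiplier,
    show ((n : ℝ) + s) / 2 - n / 2 = s / 2 by ring]
  congr 1
  have hpi : 0 < π ^ ((n : ℝ) / 2) := by positivity
  rw [sigmaConst]
  field_simp

theorem norm_fourier_poissonKerDeriv_sq (hs : s ∈ Ioo (0 : ℝ) 2) (hz : 0 < z)
    {ξ : EuclideanSpace ℝ (Fin n)} (hξ : ξ ≠ 0) :
    ‖𝓕 (fun x => (poissonKerDeriv n s z x : ℂ)) ξ‖ ^ 2 =
      poissonDerivMultiplier s z (π ^ 2 * ‖ξ‖ ^ 2) ^ 2 := by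
  obtain ⟨hs0, hs2⟩ := hs
  have he : 0 < ((n : ℝ) + s) / 2 := by positivity
  have hG : 0 < Real.Gamma (((n : ℝ) + s) / 2) := Gamma_pos_of_pos he
  have hG' : 0 < Real.Gamma (s / 2) := Gamma_pos_of_pos (by positivity)
  have hb : 0 < π ^ 2 * ‖ξ‖ ^ 2 := by positivity
  have hrec := subordInt_recurrence (a := s / 2) ⟨by linarith, by linarith⟩ hz hb
  simp only [poissonKerDeriv]
  rw [fourier_ofReal_sub ((integrable_rpow_neg_norm (by linarith) hz).const_mul _)
    ((integrable_rpow_neg_norm (by linarith) hz).const_mul _), fourier_ofReal_const_mul,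
    fourier_ofReal_const_mul, fourier_rpow_neg_norm (by linarith) hz,
    fourier_rpow_neg_norm (by linarith) hz, ← Complex.ofReal_mul, ← Complex.ofReal_mul,
    ← Complex.ofReal_sub, Complex.norm_real, norm_eq_abs, sq_abs, poissonDerivMultiplier,
    show ((n : ℝ) + s) / 2 - n / 2 = s / 2 by ring,
    show ((n : ℝ) + s) / 2 + 1 - n / 2 = s / 2 + 1 by ring, Gamma_add_one he.ne', sigmaConst,
    rpow_sub_one hz.ne', rpow_add_one hz.ne', ← neg_sq (2 / Real.Gamma (s / 2) * _ * _ * _)]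
  congr 1
  have hpi : 0 < π ^ ((n : ℝ) / 2) := by positivity
  have hns : 0 < (n : ℝ) + s := by positivity
  set b := π ^ 2 * ‖ξ‖ ^ 2
  rw [mul_assoc _ b (subordInt _ _ _), show b * subordInt (s / 2 - 1) z b =
    z ^ 2 * subordInt (s / 2 + 1) z b - s / 2 * subordInt (s / 2) z b by linarith]
  field_simp
  ring

end Kernel

theorem SchwartzMap.hasDerivAt_comp_add_smul {n : ℕ}
    (u : SchwartzMap (EuclideanSpace ℝ (Fin n)) ℝ) (x m : EuclideanSpace ℝ (Fin n)) (r : ℝ) :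
    HasDerivAt (fun r : ℝ => u (x + r • m)) (∂_{m} u (x + r • m)) r := by
  have h1 : HasDerivAt (fun r : ℝ => x + r • m) m r := by
    simpa using ((hasDerivAt_id r).smul_const m).const_add x
  exact (u.differentiableAt (x := x + r • m)).hasFDerivAt.comp_hasDerivAt r h1

theorem hasDerivAt_conv_line {n : ℕ} {k : EuclideanSpace ℝ (Fin n) → ℝ} (hk : Integrable k)
    (u : SchwartzMap (EuclideanSpace ℝ (Fin n)) ℝ) (x m : EuclideanSpace ℝ (Fin n)) :
    HasDerivAt (fun r : ℝ => ∫ y, k (x + r • m - y) * u y) (∫ y, k (x - y) * ∂_{m} u y) 0 := by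
  have hb : ∃ C, ∀ y, ‖∂_{m} u y‖ ≤ C :=
    ⟨_, (∂_{m} u).toBoundedContinuousFunction.norm_coe_le_norm⟩
  obtain ⟨C, hC⟩ := hb
  have hu : ∃ C, ∀ y, ‖u y‖ ≤ C := ⟨_, u.toBoundedContinuousFunction.norm_coe_le_norm⟩
  obtain ⟨C', hC'⟩ := hu
  have hsub : ∀ r : ℝ, (fun w => k w * u (x + r • m - w)) =
      fun w => k w * u (x - w + r • m) := fun r => by
    ext w
    rw [add_sub_right_comm]
  have h := hasDerivAt_integral_of_dominated_loc_of_deriv_le (μ := volume)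
    (F := fun (r : ℝ) w => k w * u (x - w + r • m))
    (F' := fun (r : ℝ) w => k w * ∂_{m} u (x - w + r • m)) (x₀ := 0) (s := univ)
    (bound := fun w => ‖k w‖ * C) Filter.univ_mem ?_ ?_ ?_ ?_ (hk.norm.mul_const C) ?_
  · convert! h.2 using 1
    · ext r
      rw [← integral_sub_left_eq_self _ volume (x + r • m)]
      congr 1
      ext w
      rw [sub_sub_cancel, add_sub_right_comm]
    · rw [← integral_sub_left_eq_self _ volume x]
      congr 1
      ext w
      rw [sub_sub_cancel, zero_smul, add_zero]
  · exact .of_forall fun r => hk.1.mul (u.continuous.comp (by fun_prop)).aestronglyMeasurable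
  · exact hk.mul_bdd (c := C') (u.continuous.comp (by fun_prop)).aestronglyMeasurable
      (.of_forall fun w => hC' _)
  · exact hk.1.mul ((∂_{m} u).continuous.comp (by fun_prop)).aestronglyMeasurable
  · refine .of_forall fun w r _ => ?_
    rw [norm_mul]
    exact mul_le_mul_of_nonneg_left (hC _) (norm_nonneg _)
  · exact .of_forall fun w r _ => (u.hasDerivAt_comp_add_smul (x - w) m r).const_mul (k w)

section Kernel

variable {n : ℕ} {s z : ℝ}

theorem continuous_poissonKer (hz : 0 < z) : Continuous (poissonKer n s z) :=
  continuous_const.mul (Continuous.rpow_const (by fun_prop) fun x => .inl (by positivity))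

theorem continuous_poissonKerDeriv (hz : 0 < z) : Continuous (poissonKerDeriv n s z) :=
  (continuous_const.mul (Continuous.rpow_const (by fun_prop) fun x => .inl (by positivity))).sub
    (continuous_const.mul (Continuous.rpow_const (by fun_prop) fun x => .inl (by positivity)))

theorem hasDerivAt_poissonKer (hz : 0 < z) (x : EuclideanSpace ℝ (Fin n)) :
    HasDerivAt (fun z => poissonKer n s z x) (poissonKerDeriv n s z x) z := by
  have hA : 0 < ‖x‖ ^ 2 + z ^ 2 := by positivity
  have h1 : HasDerivAt (fun z : ℝ => sigmaConst n s * z ^ s)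
      (sigmaConst n s * (s * z ^ (s - 1))) z :=
    (hasDerivAt_rpow_const (.inl hz.ne')).const_mul _
  have h2 : HasDerivAt (fun z : ℝ => ‖x‖ ^ 2 + z ^ 2) (2 * z) z := by
    simpa using (hasDerivAt_pow 2 z).const_add (‖x‖ ^ 2)
  have h3 := h2.rpow_const (p := -(((n : ℝ) + s) / 2)) (.inl hA.ne')
  convert! h1.mul h3 using 1
  rw [poissonKerDeriv, rpow_add_one hz.ne', neg_add]
  rw [← sub_eq_add_neg]
  ring

theorem sigmaConst_nonneg (hs : 0 < s) : 0 ≤ sigmaConst n s := by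
  have := Gamma_pos_of_pos (show 0 < ((n : ℝ) + s) / 2 by positivity)
  have := Gamma_pos_of_pos (show 0 < s / 2 by positivity)
  unfold sigmaConst
  positivity

theorem poissonKer_le (hs : 0 < s) (hz : 0 < z) (x : EuclideanSpace ℝ (Fin n)) :
    ‖poissonKer n s z x‖ ≤ sigmaConst n s * z ^ (-(n : ℝ)) := by
  have hσ := sigmaConst_nonneg (n := n) hs
  rw [norm_of_nonneg (by unfold poissonKer; positivity), poissonKer, mul_assoc]
  refine mul_le_mul_of_nonneg_left ?_ hσ
  calc z ^ s * (‖x‖ ^ 2 + z ^ 2) ^ (-(((n : ℝ) + s) / 2))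
      ≤ z ^ s * (z ^ 2) ^ (-(((n : ℝ) + s) / 2)) := by
        refine mul_le_mul_of_nonneg_left ?_ (by positivity)
        refine rpow_le_rpow_of_nonpos (by positivity) (by nlinarith [sq_nonneg ‖x‖]) ?_
        have : 0 ≤ ((n : ℝ) + s) / 2 := by positivity
        linarith
    _ = z ^ (-(n : ℝ)) := by
        rw [← rpow_natCast z 2, ← rpow_mul hz.le, ← rpow_add hz]
        congr 1
        push_cast
        ring

theorem poissonKerDeriv_le (hs : 0 < s) (hz : 0 < z) (x : EuclideanSpace ℝ (Fin n)) :
    ‖poissonKerDeriv n s z x‖ ≤ sigmaConst n s * (n + 2 * s) * z ^ (-(n : ℝ) - 1) := by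
  have hσ := sigmaConst_nonneg (n := n) hs
  have hk : ∀ e : ℝ, 0 ≤ e → (‖x‖ ^ 2 + z ^ 2) ^ (-e) ≤ z ^ (-2 * e) := fun e he => by
    calc (‖x‖ ^ 2 + z ^ 2) ^ (-e) ≤ (z ^ 2) ^ (-e) :=
          rpow_le_rpow_of_nonpos (by positivity) (by nlinarith [sq_nonneg ‖x‖]) (by linarith)
      _ = _ := by
          rw [← rpow_natCast z 2, ← rpow_mul hz.le]
          congr 1
          push_cast
          ring
  have h1 := hk (((n : ℝ) + s) / 2) (by positivity)
  have h2 := hk (((n : ℝ) + s) / 2 + 1) (by positivity)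
  refine (norm_sub_le _ _).trans ?_
  rw [norm_of_nonneg (by positivity), norm_of_nonneg (by positivity)]
  calc _ ≤ sigmaConst n s * (s * z ^ (s - 1)) * z ^ (-2 * (((n : ℝ) + s) / 2)) +
        sigmaConst n s * (((n : ℝ) + s) * z ^ (s + 1)) *
          z ^ (-2 * (((n : ℝ) + s) / 2 + 1)) := by gcongr
    _ = sigmaConst n s * s * (z ^ (s - 1) * z ^ (-2 * (((n : ℝ) + s) / 2))) +
        sigmaConst n s * ((n : ℝ) + s) * (z ^ (s + 1) * z ^ (-2 * (((n : ℝ) + s) / 2 + 1))) := by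
        ring
    _ = _ := by
        rw [← rpow_add hz, ← rpow_add hz,
          show s - 1 + -2 * (((n : ℝ) + s) / 2) = -n - 1 by ring,
          show s + 1 + -2 * (((n : ℝ) + s) / 2 + 1) = -n - 1 by ring]
        ring

theorem hasDerivAt_poisson_extension (hs : 0 < s) (hz : 0 < z)
    (u : SchwartzMap (EuclideanSpace ℝ (Fin n)) ℝ) (x : EuclideanSpace ℝ (Fin n)) :
    HasDerivAt (fun z : ℝ => ∫ y, poissonKer n s z (x - y) * u y)
      (∫ y, poissonKerDeriv n s z (x - y) * u y) z := by
  have hσ := sigmaConst_nonneg (n := n) hs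
  refine (hasDerivAt_integral_of_dominated_loc_of_deriv_le (μ := volume) (s := Ioi (z / 2))
    (F := fun z y => poissonKer n s z (x - y) * u y)
    (F' := fun z y => poissonKerDeriv n s z (x - y) * u y)
    (bound := fun y => sigmaConst n s * (n + 2 * s) * (z / 2) ^ (-(n : ℝ) - 1) * ‖u y‖)
    (Ioi_mem_nhds (half_lt_self hz)) ?_ ?_ ?_ ?_ ((u.integrable (μ := volume)).norm.const_mul _) ?_).2
  · filter_upwards [Ioi_mem_nhds hz] with z hz
    exact (((continuous_poissonKer hz).comp (by fun_prop)).mul u.continuous).aestronglyMeasurable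
  · exact u.integrable.bdd_mul ((continuous_poissonKer hz).comp
      (by fun_prop)).aestronglyMeasurable (.of_forall fun y => poissonKer_le hs hz _)
  · exact (((continuous_poissonKerDeriv hz).comp
      (by fun_prop)).mul u.continuous).aestronglyMeasurable
  · refine .of_forall fun y w (hw : z / 2 < w) => ?_
    have hw0 : 0 < w := by linarith
    rw [norm_mul]
    refine mul_le_mul_of_nonneg_right ((poissonKerDeriv_le hs hw0 _).trans ?_) (norm_nonneg _)
    refine mul_le_mul_of_nonneg_left ?_ (by positivity)
    refine rpow_le_rpow_of_nonpos (by positivity) hw.le ?_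
    have : (0 : ℝ) ≤ n := by positivity
    linarith
  · refine .of_forall fun y w (hw : z / 2 < w) => ?_
    exact (hasDerivAt_poissonKer (by linarith) _).mul_const _

end Kernel

theorem sum_norm_fourier_lineDeriv_sq {n : ℕ} (u : SchwartzMap (EuclideanSpace ℝ (Fin n)) ℝ)
    (ξ : EuclideanSpace ℝ (Fin n)) :
    ∑ i : Fin n, ‖𝓕 (SchwartzMap.complexify (∂_{EuclideanSpace.single i (1 : ℝ)} u)) ξ‖ ^ 2 =
      4 * (π ^ 2 * ‖ξ‖ ^ 2) * ‖𝓕 u.complexify ξ‖ ^ 2 := by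
  have h : ∀ i : Fin n, ‖𝓕 (SchwartzMap.complexify (∂_{EuclideanSpace.single i (1 : ℝ)} u)) ξ‖ ^ 2 =
      4 * π ^ 2 * ‖𝓕 u.complexify ξ‖ ^ 2 * ‖ξ i‖ ^ 2 := by
    intro i
    have e : (SchwartzMap.complexify (∂_{EuclideanSpace.single i (1 : ℝ)} u)) =
        ∂_{EuclideanSpace.single i (1 : ℝ)} u.complexify := by
      ext x
      have h1 : HasFDerivAt u.complexify (Complex.ofRealCLM.comp (fderiv ℝ u x)) x :=
        Complex.ofRealCLM.hasFDerivAt.comp x u.differentiableAt.hasFDerivAt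
      rw [SchwartzMap.complexify_apply, SchwartzMap.lineDerivOp_apply_eq_fderiv,
        SchwartzMap.lineDerivOp_apply_eq_fderiv, h1.fderiv]
      rfl
    have hg : (fun x : EuclideanSpace ℝ (Fin n) =>
        inner ℝ x (EuclideanSpace.single i (1 : ℝ))).HasTemperateGrowth := by fun_prop
    rw [e, SchwartzMap.fourier_lineDerivOp_eq, smul_apply, SchwartzMap.smulLeftCLM_apply_apply hg,
      norm_smul, norm_smul, EuclideanSpace.inner_single_right]
    simp [abs_of_pos pi_pos, mul_pow]
    ring
  simp_rw [h]
  rw [← Finset.mul_sum, EuclideanSpace.norm_sq_eq]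
  ring

section Energy

variable {n : ℕ} {s : ℝ}

theorem measurable_poissonKer_conv (v : SchwartzMap (EuclideanSpace ℝ (Fin n)) ℝ) :
    Measurable fun q : EuclideanSpace ℝ (Fin n) × ℝ =>
      ∫ y, poissonKer n s q.2 (q.1 - y) * v y := by
  have hv : Measurable v := v.continuous.measurable
  refine StronglyMeasurable.measurable (StronglyMeasurable.integral_prod_right
    (f := fun (q : EuclideanSpace ℝ (Fin n) × ℝ) y => poissonKer n s q.2 (q.1 - y) * v y) ?_)
  refine Measurable.stronglyMeasurable ?_
  simp only [poissonKer, Function.uncurry_def]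
  fun_prop

theorem measurable_poissonKerDeriv_conv (v : SchwartzMap (EuclideanSpace ℝ (Fin n)) ℝ) :
    Measurable fun q : EuclideanSpace ℝ (Fin n) × ℝ =>
      ∫ y, poissonKerDeriv n s q.2 (q.1 - y) * v y := by
  have hv : Measurable v := v.continuous.measurable
  refine StronglyMeasurable.measurable (StronglyMeasurable.integral_prod_right
    (f := fun (q : EuclideanSpace ℝ (Fin n) × ℝ) y => poissonKerDeriv n s q.2 (q.1 - y) * v y) ?_)
  refine Measurable.stronglyMeasurable ?_
  simp only [poissonKerDeriv, Function.uncurry_def]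
  fun_prop

/-- The energy density of the Poisson extension, with the derivatives written as convolutions. -/
noncomputable def poissonEnergyDensity (n : ℕ) (s : ℝ)
    (u : SchwartzMap (EuclideanSpace ℝ (Fin n)) ℝ) (q : EuclideanSpace ℝ (Fin n) × ℝ) : ℝ :=
  q.2 ^ (1 - s) *
    ((∑ i : Fin n, (∫ y, poissonKer n s q.2 (q.1 - y) *
        ∂_{EuclideanSpace.single i (1 : ℝ)} u y) ^ 2) +
      (∫ y, poissonKerDeriv n s q.2 (q.1 - y) * u y) ^ 2)

theorem measurable_poissonEnergyDensity (u : SchwartzMap (EuclideanSpace ℝ (Fin n)) ℝ) :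
    Measurable (poissonEnergyDensity n s u) := by
  have h1 := fun i : Fin n => measurable_poissonKer_conv (s := s)
    (∂_{EuclideanSpace.single i (1 : ℝ)} u)
  have h2 := measurable_poissonKerDeriv_conv (s := s) u
  unfold poissonEnergyDensity
  fun_prop

theorem lintegral_poissonEnergyDensity_slice (hn : 1 ≤ n) (hs : s ∈ Ioo (0 : ℝ) 2)
    (u : SchwartzMap (EuclideanSpace ℝ (Fin n)) ℝ) {z : ℝ} (hz : 0 < z) :
    ∫⁻ x, ENNReal.ofReal (poissonEnergyDensity n s u (x, z)) =
      ∫⁻ ξ, ENNReal.ofReal (‖𝓕 u.complexify ξ‖ ^ 2) * ENNReal.ofReal (z ^ (1 - s) *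
        (4 * (π ^ 2 * ‖ξ‖ ^ 2) * poissonMultiplier s z (π ^ 2 * ‖ξ‖ ^ 2) ^ 2 +
          poissonDerivMultiplier s z (π ^ 2 * ‖ξ‖ ^ 2) ^ 2)) := by
  have : Nonempty (Fin n) := ⟨⟨0, hn⟩⟩
  have : Nontrivial (EuclideanSpace ℝ (Fin n)) := inferInstance
  have hFc : ∀ v : SchwartzMap (EuclideanSpace ℝ (Fin n)) ℂ, Measurable fun ξ => 𝓕 v ξ :=
    fun v => (𝓕 v).continuous.measurable
  have hFk : ∀ k : EuclideanSpace ℝ (Fin n) → ℝ, Integrable k →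
      Measurable (𝓕 (fun x => (k x : ℂ))) := fun k hk =>
    (VectorFourier.fourierIntegral_continuous continuous_fourierChar continuous_inner
      hk.ofReal).measurable
  have hkm := hFk _ (integrable_poissonKer (n := n) hs.1 hz)
  have hkm' := hFk _ (integrable_poissonKerDeriv (n := n) hs.1 hz)
  have h1 : ∀ i : Fin n, Measurable fun x : EuclideanSpace ℝ (Fin n) =>
      ∫ y, poissonKer n s z (x - y) * ∂_{EuclideanSpace.single i (1 : ℝ)} u y := fun i =>
    (measurable_poissonKer_conv (s := s) (∂_{EuclideanSpace.single i (1 : ℝ)} u)).comp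
      (measurable_id.prodMk measurable_const)
  have hu1 := hFc u.complexify
  have hu2 : ∀ i : Fin n, Measurable fun ξ =>
      𝓕 (SchwartzMap.complexify (∂_{EuclideanSpace.single i (1 : ℝ)} u)) ξ := fun i => hFc _
  calc _ = ENNReal.ofReal (z ^ (1 - s)) * ∫⁻ x : EuclideanSpace ℝ (Fin n),
        (∑ i : Fin n, ENNReal.ofReal ((∫ y, poissonKer n s z (x - y) *
          ∂_{EuclideanSpace.single i (1 : ℝ)} u y) ^ 2) +
        ENNReal.ofReal ((∫ y, poissonKerDeriv n s z (x - y) * u y) ^ 2)) := by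
        rw [← lintegral_const_mul' _ _ ENNReal.ofReal_ne_top]
        refine lintegral_congr fun x => ?_
        rw [poissonEnergyDensity, ENNReal.ofReal_mul (by positivity),
          ENNReal.ofReal_add (by positivity) (by positivity),
          ENNReal.ofReal_sum_of_nonneg fun _ _ => by positivity]
    _ = ENNReal.ofReal (z ^ (1 - s)) *
        ((∑ i : Fin n, ∫⁻ ξ, ENNReal.ofReal (‖𝓕 (fun x => (poissonKer n s z x : ℂ)) ξ‖ ^ 2 *
          ‖𝓕 (SchwartzMap.complexify (∂_{EuclideanSpace.single i (1 : ℝ)} u)) ξ‖ ^ 2)) +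
        ∫⁻ ξ, ENNReal.ofReal (‖𝓕 (fun x => (poissonKerDeriv n s z x : ℂ)) ξ‖ ^ 2 *
          ‖𝓕 u.complexify ξ‖ ^ 2)) := by
        congr 1
        rw [lintegral_add_left (by fun_prop), lintegral_finsetSum _ (fun i _ => by fun_prop),
          lintegral_conv_sq (integrable_poissonKerDeriv hs.1 hz)]
        simp_rw [lintegral_conv_sq (integrable_poissonKer hs.1 hz)]
    _ = _ := by
        rw [← lintegral_finsetSum _ (fun i _ => by fun_prop), ← lintegral_add_left (by fun_prop),
          ← lintegral_const_mul' _ _ ENNReal.ofReal_ne_top]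
        refine lintegral_congr_ae ?_
        filter_upwards [Measure.ae_ne volume (0 : EuclideanSpace ℝ (Fin n))] with ξ hξ
        rw [← ENNReal.ofReal_sum_of_nonneg fun _ _ => by positivity,
          ← ENNReal.ofReal_add (by positivity) (by positivity),
          ← ENNReal.ofReal_mul (by positivity), ← ENNReal.ofReal_mul (by positivity),
          ← Finset.mul_sum, sum_norm_fourier_lineDeriv_sq, norm_fourier_poissonKer_sq hs.1 hz,
          norm_fourier_poissonKerDeriv_sq hs hz hξ]
        congr 1
        ring

theorem measurable_subordInt_norm (c : ℝ) : Measurable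
    fun p : ℝ × EuclideanSpace ℝ (Fin n) => subordInt c p.1 (π ^ 2 * ‖p.2‖ ^ 2) :=
  Measurable.comp (g := fun p : ℝ × ℝ => subordInt c p.1 p.2)
    (f := fun p : ℝ × EuclideanSpace ℝ (Fin n) => (p.1, π ^ 2 * ‖p.2‖ ^ 2))
    (measurable_subordInt c) (by fun_prop)

theorem measurable_multiplier_energy (s : ℝ) : Measurable
    fun p : ℝ × EuclideanSpace ℝ (Fin n) => p.1 ^ (1 - s) *
      (4 * (π ^ 2 * ‖p.2‖ ^ 2) * poissonMultiplier s p.1 (π ^ 2 * ‖p.2‖ ^ 2) ^ 2 +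
        poissonDerivMultiplier s p.1 (π ^ 2 * ‖p.2‖ ^ 2) ^ 2) := by
  have h1 := measurable_subordInt_norm (n := n) (s / 2)
  have h2 := measurable_subordInt_norm (n := n) (s / 2 - 1)
  unfold poissonMultiplier poissonDerivMultiplier
  fun_prop

theorem lintegral_poissonEnergyDensity (hn : 1 ≤ n) (hs : s ∈ Ioo (0 : ℝ) 2)
    (u : SchwartzMap (EuclideanSpace ℝ (Fin n)) ℝ) :
    ∫⁻ q in (univ : Set (EuclideanSpace ℝ (Fin n))) ×ˢ Ioi (0 : ℝ),
        ENNReal.ofReal (poissonEnergyDensity n s u q) =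
      ∫⁻ ξ, ENNReal.ofReal (‖𝓕 u.complexify ξ‖ ^ 2) * ENNReal.ofReal
        (2 * (π ^ 2 * ‖ξ‖ ^ 2) ^ (s / 2) * Real.Gamma (1 - s / 2) / Real.Gamma (s / 2)) := by
  have : Nonempty (Fin n) := ⟨⟨0, hn⟩⟩
  have : Nontrivial (EuclideanSpace ℝ (Fin n)) := inferInstance
  have hm := (measurable_poissonEnergyDensity (s := s) u).ennreal_ofReal
  have hFm : Measurable fun p : ℝ × EuclideanSpace ℝ (Fin n) =>
      ENNReal.ofReal (‖𝓕 u.complexify p.2‖ ^ 2) :=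
    (((𝓕 u.complexify).continuous.measurable.comp measurable_snd).norm.pow_const 2).ennreal_ofReal
  have hM := (measurable_multiplier_energy (n := n) s).ennreal_ofReal
  calc _ = ∫⁻ z in Ioi (0 : ℝ), ∫⁻ x, ENNReal.ofReal (poissonEnergyDensity n s u (x, z)) := by
        rw [Measure.volume_eq_prod, ← Measure.prod_restrict, Measure.restrict_univ,
          lintegral_prod_symm _ hm.aemeasurable]
    _ = ∫⁻ z in Ioi (0 : ℝ), ∫⁻ ξ : EuclideanSpace ℝ (Fin n),
        ENNReal.ofReal (‖𝓕 u.complexify ξ‖ ^ 2) * ENNReal.ofReal (z ^ (1 - s) *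
        (4 * (π ^ 2 * ‖ξ‖ ^ 2) * poissonMultiplier s z (π ^ 2 * ‖ξ‖ ^ 2) ^ 2 +
          poissonDerivMultiplier s z (π ^ 2 * ‖ξ‖ ^ 2) ^ 2)) :=
        setLIntegral_congr_fun measurableSet_Ioi fun z (hz : 0 < z) =>
          lintegral_poissonEnergyDensity_slice hn hs u hz
    _ = ∫⁻ ξ : EuclideanSpace ℝ (Fin n), ∫⁻ z in Ioi (0 : ℝ),
        ENNReal.ofReal (‖𝓕 u.complexify ξ‖ ^ 2) * ENNReal.ofReal (z ^ (1 - s) *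
        (4 * (π ^ 2 * ‖ξ‖ ^ 2) * poissonMultiplier s z (π ^ 2 * ‖ξ‖ ^ 2) ^ 2 +
          poissonDerivMultiplier s z (π ^ 2 * ‖ξ‖ ^ 2) ^ 2)) :=
        lintegral_lintegral_swap (hFm.mul hM).aemeasurable
    _ = _ := by
        refine lintegral_congr_ae ?_
        filter_upwards [Measure.ae_ne volume (0 : EuclideanSpace ℝ (Fin n))] with ξ hξ
        rw [lintegral_const_mul' _ _ ENNReal.ofReal_ne_top,
          lintegral_multiplier_energy hs (by positivity)]

theorem betaConst_nonneg (hs : s ∈ Ioo (0 : ℝ) 2) : 0 ≤ betaConst s := by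
  have hG : 0 < Real.Gamma (s / 2) := Gamma_pos_of_pos (by linarith [hs.1])
  have hG' : 0 < Real.Gamma (1 - s / 2) := Gamma_pos_of_pos (by linarith [hs.2])
  unfold betaConst
  positivity

theorem two_betaConst_mul_lintegral_poissonEnergyDensity (hn : 1 ≤ n) (hs : s ∈ Ioo (0 : ℝ) 2)
    (u : SchwartzMap (EuclideanSpace ℝ (Fin n)) ℝ) :
    ENNReal.ofReal (2 * betaConst s) *
        ∫⁻ q in (univ : Set (EuclideanSpace ℝ (Fin n))) ×ˢ Ioi (0 : ℝ),
          ENNReal.ofReal (poissonEnergyDensity n s u q) =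
      ∫⁻ ξ, ENNReal.ofReal (2 * 2 ^ s * (π ^ 2 * ‖ξ‖ ^ 2) ^ (s / 2) *
        ‖𝓕 u.complexify ξ‖ ^ 2) := by
  have hG : 0 < Real.Gamma (s / 2) := Gamma_pos_of_pos (by linarith [hs.1])
  have hG' : 0 < Real.Gamma (1 - s / 2) := Gamma_pos_of_pos (by linarith [hs.2])
  have hβ := betaConst_nonneg hs
  rw [lintegral_poissonEnergyDensity hn hs, ← lintegral_const_mul' _ _ ENNReal.ofReal_ne_top]
  refine lintegral_congr fun ξ => ?_
  rw [← ENNReal.ofReal_mul (by positivity), ← ENNReal.ofReal_mul (by positivity)]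
  congr 1
  rw [betaConst, rpow_sub_one two_ne_zero]
  generalize Real.Gamma (1 - s / 2) = g at hG' ⊢
  field_simp

end Energy

/-- Energy identity for the Euclidean Caffarelli–Silvestre extension: the Gagliardo
`H^{s/2}`-energy of a Schwartz function `u` equals `2β_s` times the weighted Dirichlet
energy of its Poisson extension. -/
theorem extension_energy_identity (n : ℕ) (hn : 1 ≤ n) (s : ℝ) (hs : s ∈ Ioo (0:ℝ) 2)
    (u : SchwartzMap (EuclideanSpace ℝ (Fin n)) ℝ)
    (U : EuclideanSpace ℝ (Fin n) → ℝ → ℝ)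
    (hU : ∀ x z, U x z =
      ∫ y, sigmaConst n s * z ^ s / (‖x - y‖ ^ 2 + z ^ 2) ^ (((n : ℝ) + s) / 2) * u y) :
    ∫ q : EuclideanSpace ℝ (Fin n) × EuclideanSpace ℝ (Fin n),
        alphaConst n s * (u q.1 - u q.2) ^ 2 / ‖q.1 - q.2‖ ^ ((n : ℝ) + s) =
      2 * betaConst s *
        ∫ q in (univ : Set (EuclideanSpace ℝ (Fin n))) ×ˢ Ioi (0:ℝ),
          q.2 ^ (1 - s) *
            ((∑ i : Fin n,
                (deriv (fun r : ℝ => U (q.1 + r • EuclideanSpace.single i (1:ℝ)) q.2) 0) ^ 2) +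
              (deriv (fun w : ℝ => U q.1 w) q.2) ^ 2) := by
  have hs0 := hs.1
  have hU' : ∀ x, ∀ z ∈ Ioi (0 : ℝ), U x z = ∫ y, poissonKer n s z (x - y) * u y := by
    intro x z hz
    rw [hU]
    congr 1
    ext y
    rw [poissonKer, rpow_neg (by positivity), div_eq_mul_inv]
  have hG : 0 < Real.Gamma (((n : ℝ) + s) / 2) := Gamma_pos_of_pos (by positivity)
  have hG' : 0 < Real.Gamma (1 - s / 2) := Gamma_pos_of_pos (by linarith [hs.2])
  have hα : 0 ≤ alphaConst n s := by
    unfold alphaConst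
    positivity
  have hβ := betaConst_nonneg hs
  have hum : Measurable u := u.continuous.measurable
  rw [integral_eq_lintegral_of_nonneg_ae (.of_forall fun q => by positivity)
    (Measurable.aestronglyMeasurable (by fun_prop)), lintegral_gagliardo hn hs,
    ← two_betaConst_mul_lintegral_poissonEnergyDensity hn hs, ENNReal.toReal_mul,
    ENNReal.toReal_ofReal (by positivity)]
  congr 1
  have hmeas : MeasurableSet ((univ : Set (EuclideanSpace ℝ (Fin n))) ×ˢ Ioi (0 : ℝ)) :=
    MeasurableSet.univ.prod measurableSet_Ioi
  rw [← integral_eq_lintegral_of_nonneg_ae]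
  · refine setIntegral_congr_fun hmeas fun q hq => ?_
    have hz : 0 < q.2 := hq.2
    have hdz : deriv (fun w : ℝ => U q.1 w) q.2 =
        ∫ y, poissonKerDeriv n s q.2 (q.1 - y) * u y := by
      refine ((hasDerivAt_poisson_extension hs0 hz u q.1).congr_of_eventuallyEq ?_).deriv
      filter_upwards [Ioi_mem_nhds hz] with w hw using hU' q.1 w hw
    have hdx : ∀ i : Fin n,
        deriv (fun r : ℝ => U (q.1 + r • EuclideanSpace.single i (1 : ℝ)) q.2) 0 =
        ∫ y, poissonKer n s q.2 (q.1 - y) * ∂_{EuclideanSpace.single i (1 : ℝ)} u y := by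
      intro i
      simp_rw [hU' _ _ hz]
      exact (hasDerivAt_conv_line (integrable_poissonKer hs0 hz) u q.1 _).deriv
    simp only [poissonEnergyDensity, hdz, hdx]
  · refine (ae_restrict_iff' hmeas).2 (.of_forall fun q hq => ?_)
    have hz : 0 < q.2 := hq.2
    unfold poissonEnergyDensity
    positivity
  · exact (measurable_poissonEnergyDensity u).aestronglyMeasurable
end
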